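/- Let G be a countable ICC group. Then for every finite symmetric X ⊆ G containing the identity with |X| ≥ 2 there exists a strongly irreducible X-witness shift S ⊆ 2^G. -/

import Mathlib

open scoped Pointwise

/-- The left-translation action of `G` on configurations: `(g • s)(h) = s (g⁻¹ * h)`. -/
def shiftAct {G A : Type*} [Group G] (g : G) (s : G → A) : G → A :=
  fun h => s (g⁻¹ * h)

/-- A shift: a nonempty, closed, `G`-invariant subset of the full shift `A^G` (with the
product topology and the left-translation action). -/
def IsShift {G A : Type*} [Group G] [TopologicalSpace A] (S : Set (G → A)) : Prop :=
  S.Nonempty ∧ IsClosed S ∧ ∀ s ∈ S, ∀ g : G, shiftAct g s ∈ S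

/-- A shift `S ⊆ A^G` is strongly irreducible if there is a finite `X ⊆ G` containing the
identity such that for all `E₁, E₂ ⊆ G` with `E₁X ∩ E₂X = ∅` and all `s₁, s₂ ∈ S` there is
`s ∈ S` agreeing with `s₁` on `E₁` and with `s₂` on `E₂`. -/
def StronglyIrreducible {G A : Type*} [Group G] (S : Set (G → A)) : Prop :=
  ∃ X : Finset G, (1 : G) ∈ X ∧
    ∀ E₁ E₂ : Set G, (E₁ * (X : Set G)) ∩ (E₂ * (X : Set G)) = ∅ →
      ∀ s₁ ∈ S, ∀ s₂ ∈ S, ∃ s ∈ S, (∀ a ∈ E₁, s a = s₁ a) ∧ (∀ a ∈ E₂, s a = s₂ a)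

/-- For a finite symmetric `X ⊆ G`, elements `a, b ∈ G` are `X`-apart if `a⁻¹ * b ∉ X`. -/
def XApart {G : Type*} [Group G] (X : Finset G) (a b : G) : Prop :=
  a⁻¹ * b ∉ X

/-- A shift `S ⊆ 2^G` is an `X`-witness shift if (1) for every `s ∈ S`, distinct `a, b` with
`s a = s b = 1` are `X`-apart, and (2) for all `s, t ∈ S` there is `a ∈ G` with
`s a = t a = 1`. -/
def IsWitnessShift {G : Type*} [Group G] (X : Finset G) (S : Set (G → Fin 2)) : Prop :=
  (∀ s ∈ S, ∀ a b : G, s a = 1 → s b = 1 → a ≠ b → XApart X a b) ∧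
  (∀ s ∈ S, ∀ t ∈ S, ∃ a : G, s a = 1 ∧ t a = 1)

/-- A group is ICC if it is nontrivial and every non-identity element has an infinite
conjugacy class. -/
def IsICC (G : Type*) [Group G] : Prop :=
  Nontrivial G ∧ ∀ g : G, g ≠ 1 → {h : G | IsConj g h}.Infinite

/-- The products of at most `n` elements of `Y`. -/
def wordBall {G : Type*} [Group G] (Y : Set G) (n : ℕ) : Set G :=
  {g | ∃ l : List G, (∀ x ∈ l, x ∈ Y) ∧ l.length ≤ n ∧ l.prod = g}

/-- An element outside `F` that conjugates no non-identity element of `F` into `F`. -/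
structure IsGeneric {G : Type*} [Group G] (F : Set G) (t : G) : Prop where
  notMem : t ∉ F
  eq_one_of_conj_mem : ∀ a ∈ F, t * a * t⁻¹ ∈ F → a = 1

/-- Points of `P` and `Q` whose difference lies in `X` coincide. -/
def CrossSep {G : Type*} [Group G] (X P Q : Set G) : Prop :=
  ∀ p ∈ P, ∀ q ∈ Q, p⁻¹ * q ∈ X → p = q

section

variable {G : Type*} [Group G]

theorem wordBall_finite {Y : Set G} (hY : Y.Finite) (n : ℕ) : (wordBall Y n).Finite := by
  have : Finite Y := hY
  have h := (List.finite_length_le Y n).image fun l => (l.map Subtype.val).prod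
  refine h.subset ?_
  rintro g ⟨l, hl, hn, rfl⟩
  refine ⟨l.attach.map fun x => ⟨x.1, hl x.1 x.2⟩, by simpa using hn, ?_⟩
  simp [Function.comp_def]

theorem wordBall_mono {Y Z : Set G} (h : Y ⊆ Z) {m n : ℕ} (hmn : m ≤ n) :
    wordBall Y m ⊆ wordBall Z n := by
  rintro g ⟨l, hl, hm, rfl⟩
  exact ⟨l, fun x hx => h (hl x hx), hm.trans hmn, rfl⟩

theorem wordBall_inv {Y : Set G} (hY : ∀ y ∈ Y, y⁻¹ ∈ Y) {n : ℕ} {g : G}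
    (hg : g ∈ wordBall Y n) : g⁻¹ ∈ wordBall Y n := by
  obtain ⟨l, hl, hm, rfl⟩ := hg
  refine ⟨(l.map (·⁻¹)).reverse, ?_, by simpa using hm, by rw [List.prod_inv_reverse]⟩
  intro x hx
  obtain ⟨y, hy, rfl⟩ : ∃ y ∈ l, y⁻¹ = x := by simpa [and_comm] using hx
  exact hY y (hl y hy)

theorem wordBall_mul {Y : Set G} {m n : ℕ} {g h : G} (hg : g ∈ wordBall Y m)
    (hh : h ∈ wordBall Y n) : g * h ∈ wordBall Y (m + n) := by
  obtain ⟨l, hl, hm, rfl⟩ := hg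
  obtain ⟨k, hk, hn, rfl⟩ := hh
  refine ⟨l ++ k, ?_, by simp; omega, by simp⟩
  intro x hx
  rcases List.mem_append.1 hx with h | h
  exacts [hl x h, hk x h]

theorem exists_mul_of_mem_wordBall {Y : Set G} {m n : ℕ} {g : G} (hg : g ∈ wordBall Y (m + n)) :
    ∃ u ∈ wordBall Y m, ∃ v ∈ wordBall Y n, u * v = g := by
  obtain ⟨l, hl, hn, rfl⟩ := hg
  exact ⟨_, ⟨l.take m, fun x hx => hl x (List.mem_of_mem_take hx), by simp, rfl⟩,
    _, ⟨l.drop m, fun x hx => hl x (List.mem_of_mem_drop hx), by simp; omega, rfl⟩,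
    List.prod_take_mul_prod_drop l m⟩

theorem one_mem_wordBall (Y : Set G) (n : ℕ) : (1 : G) ∈ wordBall Y n :=
  ⟨[], by simp, by simp, by simp⟩

theorem subset_wordBall (Y : Set G) {n : ℕ} (hn : 1 ≤ n) : Y ⊆ wordBall Y n :=
  fun y hy => ⟨[y], by simpa using hy, by simpa using hn, by simp⟩

theorem IsICC.infinite (h : IsICC G) : Infinite G := by
  obtain ⟨_, h⟩ := h
  obtain ⟨g, hg⟩ := exists_ne (1 : G)
  exact Set.infinite_univ_iff.1 ((h g hg).mono (Set.subset_univ _))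

theorem IsICC.not_finiteIndex_centralizer (h : IsICC G) {a : G} (ha : a ≠ 1) :
    ¬ (Subgroup.centralizer {a}).FiniteIndex := by
  intro hf
  have hfin : Finite (G ⧸ Subgroup.centralizer {a}) := inferInstance
  refine h.2 a ha ?_
  let f : G ⧸ Subgroup.centralizer {a} → G := Quotient.lift (fun g => g * a * g⁻¹) (by
    intro x y hxy
    have := QuotientGroup.leftRel_apply.1 hxy
    rw [Subgroup.mem_centralizer_singleton_iff] at this
    calc x * a * x⁻¹ = x * (a * (x⁻¹ * y)) * y⁻¹ := by group
      _ = x * ((x⁻¹ * y) * a) * y⁻¹ := by rw [this]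
      _ = y * a * y⁻¹ := by group)
  refine (Set.finite_range f).subset ?_
  intro b hb
  obtain ⟨g, hg⟩ := isConj_iff.1 hb
  exact ⟨(g : G ⧸ Subgroup.centralizer {a}), hg⟩

theorem IsICC.exists_isGeneric (h : IsICC G) {F : Set G} (hF : F.Finite) :
    ∃ t, IsGeneric F t := by
  classical
  have := h.infinite
  by_contra! hcon
  let F' : Finset G := insert 1 hF.toFinset
  let H : G × G → Subgroup G := fun p => if p.1 = 1 then ⊥ else Subgroup.centralizer {p.1}
  let g : G × G → G := fun p => if p.1 = 1 then p.2 else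
    if h : ∃ t : G, t * p.1 * t⁻¹ = p.2 then h.choose else 1
  have hcov : ⋃ i ∈ F' ×ˢ F', g i • (H i : Set G) = Set.univ := by
    refine Set.eq_univ_of_forall fun t => ?_
    simp only [Set.mem_iUnion]
    by_cases ht : t ∈ F
    · exact ⟨(1, t), by simp [F', ht], by simp [g, H]⟩
    · have : ∃ a ∈ F, t * a * t⁻¹ ∈ F ∧ a ≠ 1 := by
        by_contra! hc
        exact hcon t ⟨ht, hc⟩
      obtain ⟨a, ha, hb, ha1⟩ := this
      refine ⟨(a, t * a * t⁻¹), by simp [F', ha, hb], ?_⟩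
      have hex : ∃ u : G, u * a * u⁻¹ = t * a * t⁻¹ := ⟨t, rfl⟩
      have hg : g (a, t * a * t⁻¹) = hex.choose := by
        simp only [g, ha1, if_false]
        exact dif_pos hex
      have hH : H (a, t * a * t⁻¹) = Subgroup.centralizer {a} := if_neg ha1
      have hs := hex.choose_spec
      rw [hg, hH, mem_leftCoset_iff]
      generalize hex.choose = u at hs
      rw [SetLike.mem_coe, Subgroup.mem_centralizer_singleton_iff]
      calc u⁻¹ * t * a = u⁻¹ * (t * a * t⁻¹) * t := by group
        _ = a * (u⁻¹ * t) := by rw [← hs]; group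
  obtain ⟨⟨a, b⟩, -, hk⟩ := Subgroup.exists_finiteIndex_of_leftCoset_cover hcov
  by_cases ha : a = 1
  · simp only [H, ha, if_true] at hk
    have := Subgroup.finite_quotient_of_finiteIndex (H := (⊥ : Subgroup G))
    exact not_finite_iff_infinite.2 ‹Infinite G›
      (Finite.of_equiv _ QuotientGroup.quotientBot.toEquiv)
  · simp only [H, ha, if_false] at hk
    exact h.not_finiteIndex_centralizer ha hk

theorem IsGeneric.mul_eq_one {F : Set G} {t c d : G} (ht : IsGeneric F t) (h : t * c * t = d)
    (hcd : c * d ∈ F) (hdc : d * c ∈ F) : c * d = 1 := by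
  refine ht.eq_one_of_conj_mem _ hcd ?_
  have : t * (c * d) * t⁻¹ = d * c := by rw [← h]; group
  rwa [this]

theorem IsGeneric.sq_eq_one {F : Set G} {t c d : G} (ht : IsGeneric F t) (h : t * c * t = d)
    (hcd : c * d ∈ F) (hdc : d * c ∈ F) : t * c * (t * c) = 1 := by
  have h1 := mul_eq_one_iff_eq_inv.1 (ht.mul_eq_one h hcd hdc)
  calc t * c * (t * c) = (t * c * t) * c := by group
    _ = 1 := by rw [h, h1]; group

theorem IsGeneric.eq_of_sq_eq_one {F : Set G} {t c d : G} (ht : IsGeneric F t)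
    (hc : t * c * (t * c) = 1) (hd : t * d * (t * d) = 1) (h1 : d * c⁻¹ ∈ F)
    (h2 : d⁻¹ * c ∈ F) : c = d := by
  have hc' : t * c * t = c⁻¹ := eq_inv_of_mul_eq_one_left (by rw [← hc]; group)
  have hd' : t * d * t = d⁻¹ := eq_inv_of_mul_eq_one_left (by rw [← hd]; group)
  have := ht.eq_one_of_conj_mem _ h1 (by
    have : t * (d * c⁻¹) * t⁻¹ = d⁻¹ * c := by
      calc t * (d * c⁻¹) * t⁻¹ = (t * d * t) * (t * c * t)⁻¹ := by group
        _ = _ := by rw [hc', hd']; group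
    rwa [this])
  exact (mul_inv_eq_one.1 this).symm

theorem exists_separated_finset [Infinite G] {X : Set G} (hX : X.Finite)
    (hXi : ∀ x ∈ X, x⁻¹ ∈ X) (n : ℕ) :
    ∃ Q : Finset G, 1 ∈ Q ∧ n + 1 = Q.card ∧ CrossSep X Q Q := by
  classical
  induction n with
  | zero => exact ⟨{1}, by simp, by simp, by simp [CrossSep]⟩
  | succ n ih =>
    obtain ⟨Q, h1, hn, hQ⟩ := ih
    have hfin : ((Q : Set G) * X ∪ Q).Finite := (Q.finite_toSet.mul hX).union Q.finite_toSet
    obtain ⟨a, ha⟩ := hfin.exists_notMem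
    have haQ : a ∉ Q := fun h => ha (Or.inr h)
    have key : ∀ q ∈ Q, q⁻¹ * a ∉ X := fun q hq h =>
      ha (Or.inl ⟨q, hq, _, h, by simp⟩)
    refine ⟨insert a Q, by simp [h1], by simp [haQ, ← hn], ?_⟩
    intro p hp q hq h
    rcases Finset.mem_insert.1 hp with rfl | hp' <;> rcases Finset.mem_insert.1 hq with rfl | hq'
    · rfl
    · exact (key q hq' (by simpa using hXi _ h)).elim
    · exact (key p hp' h).elim
    · exact hQ p hp' q hq' h

end

/-- The data from which `exists_core` assembles a separated set `P` and a separated set of right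
translators for `P`. -/
structure CoreData {G : Type*} [Group G] (X Q R Y Z : Set G) (v v' t : G) (β δ : G → G)
    (γ : G → G → G) : Prop where
  one_mem : 1 ∈ X
  sepX : CrossSep (wordBall X 3) Q Q
  inv_mem : ∀ x ∈ X, x⁻¹ ∈ X
  inv_mem_Y : ∀ y, y⁻¹ ∈ Y ↔ y ∈ Y
  inv_mem_Z : ∀ z, z⁻¹ ∈ Z ↔ z ∈ Z
  X_Y : X ⊆ Y
  X_Z : X ⊆ Z
  Q_Z : Q ⊆ Z
  R_Y : R ⊆ Y
  Q_R : Q ⊆ R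
  v_R : v ∈ R
  R_cases : ∀ r ∈ R, r = v ∨ r ∈ Q
  generic_v : IsGeneric (wordBall Z 12) v
  generic_t : IsGeneric (wordBall Y 12) t
  v'_mem : v' ∈ Q
  v'_sq : ∀ z ∈ wordBall X 2, v * (z * v'⁻¹) * (v * (z * v'⁻¹)) ≠ 1
  δ_v : δ v = v'
  δ_Q : ∀ q ∈ Q, δ q = v
  β_mem : ∀ y ∈ X, y ≠ 1 → β y ∈ Q
  β_ne : ∀ y ∈ X, y ≠ 1 → ∀ g ∈ R * X * R⁻¹, ∀ ξ ∈ X, g * t * ξ ≠ t * y * t⁻¹ * β y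
  γ_mem : ∀ q ∈ R, ∀ y ∈ X, γ q y ∈ Q
  γ_sq_v : ∀ q ∈ R, ∀ y ∈ X, ∀ z ∈ wordBall X 2,
    v * (z * (γ q y)⁻¹) * (v * (z * (γ q y)⁻¹)) ≠ 1
  γ_sq_t : ∀ q ∈ R, ∀ y ∈ X, ∀ ξ ∈ X, t * (ξ * (γ q y)⁻¹) * (t * (ξ * (γ q y)⁻¹)) ≠ 1
  γ_ne : ∀ q ∈ R, ∀ y ∈ X, ∀ y' ∈ X, y' ≠ 1 → ∀ ξ ∈ X,
    t * y' * t⁻¹ * β y' * ξ ≠ q * y * t⁻¹ * γ q y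

section

variable {G : Type*} [Group G]

theorem CrossSep.of_mul_eq {X P Q : Set G}
    (h : ∀ p ∈ P, ∀ q ∈ Q, ∀ ξ ∈ X, p * ξ = q → ξ = 1) : CrossSep X P Q := by
  intro p hp q hq hpq
  exact inv_mul_eq_one.1 (h p hp q hq _ hpq (by simp))

theorem CrossSep.symm {X P Q : Set G} (hX : ∀ x ∈ X, x⁻¹ ∈ X) (h : CrossSep X P Q) :
    CrossSep X Q P :=
  fun q hq p hp hqp => (h p hp q hq (by simpa using hX _ hqp)).symm

theorem CrossSep.union_left {X P P' Q : Set G} (h : CrossSep X P Q) (h' : CrossSep X P' Q) :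
    CrossSep X (P ∪ P') Q := by
  rintro p (hp | hp)
  exacts [h p hp, h' p hp]

theorem CrossSep.union_right {X P Q Q' : Set G} (h : CrossSep X P Q) (h' : CrossSep X P Q') :
    CrossSep X P (Q ∪ Q') := by
  rintro p hp q (hq | hq)
  exacts [h p hp q hq, h' p hp q hq]

theorem mem_mul_mul_inv {A B C : Set G} {g : G} :
    g ∈ A * B * C⁻¹ ↔ ∃ a ∈ A, ∃ b ∈ B, ∃ c ∈ C, g = a * b * c⁻¹ := by
  constructor
  · rintro ⟨_, ⟨a, ha, b, hb, rfl⟩, c, hc, rfl⟩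
    exact ⟨a, ha, b, hb, c⁻¹, hc, by simp⟩
  · rintro ⟨a, ha, b, hb, c, hc, rfl⟩
    exact Set.mul_mem_mul (Set.mul_mem_mul ha hb) (Set.inv_mem_inv.2 hc)

namespace CoreData

variable {X Q R Y Z : Set G} {v v' t : G} {β δ : G → G} {γ : G → G → G}

theorem δ_mem (h : CoreData X Q R Y Z v v' t β δ γ) {q : G} (hq : q ∈ R) : δ q ∈ R := by
  rcases h.R_cases q hq with rfl | hq
  · rw [h.δ_v]; exact h.Q_R h.v'_mem
  · rw [h.δ_Q q hq]; exact h.v_R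

theorem v_ne_mul (h : CoreData X Q R Y Z v v' t β δ γ) {q z : G} (hq : q ∈ Q)
    (hz : z ∈ wordBall X 3) : v ≠ q * z := by
  rintro rfl
  exact h.generic_v.notMem (wordBall_mono subset_rfl (by simp)
    (wordBall_mul (subset_wordBall Z le_rfl (h.Q_Z hq)) (wordBall_mono h.X_Z le_rfl hz)))

theorem inv_mul_δ_notMem (h : CoreData X Q R Y Z v v' t β δ γ) {q z : G} (hq : q ∈ R)
    (hz : z ∈ wordBall X 3) : q⁻¹ * δ q ≠ z := by
  intro e
  rcases h.R_cases q hq with rfl | hq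
  · refine h.v_ne_mul h.v'_mem (wordBall_inv h.inv_mem hz) ?_
    rw [← e, h.δ_v]; group
  · refine h.v_ne_mul hq hz ?_
    rw [← e, h.δ_Q q hq]; group

theorem crossSep_R (h : CoreData X Q R Y Z v v' t β δ γ) : CrossSep (wordBall X 3) R R := by
  intro p hp q hq hpq
  rcases h.R_cases p hp with rfl | hp <;> rcases h.R_cases q hq with rfl | hq
  · rfl
  · exact (h.v_ne_mul hq (wordBall_inv h.inv_mem hpq) (by group)).elim
  · exact (h.v_ne_mul hp hpq (by group)).elim
  · exact h.sepX p hp q hq hpq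

theorem crossSep_translate (h : CoreData X Q R Y Z v v' t β δ γ) :
    CrossSep X ((· * t) '' (R * X * R⁻¹)) ((· * t) '' (R * X * R⁻¹)) := by
  apply CrossSep.of_mul_eq
  rintro _ ⟨g, hg, rfl⟩ _ ⟨g', hg', rfl⟩ ξ hξ heq
  beta_reduce at heq
  obtain ⟨a, ha, x, hx, b, hb, rfl⟩ := mem_mul_mul_inv.1 hg
  obtain ⟨a', ha', x', hx', b', hb', rfl⟩ := mem_mul_mul_inv.1 hg'
  refine h.generic_t.eq_one_of_conj_mem ξ (subset_wordBall Y (by simp) (h.X_Y hξ)) ?_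
  have e : t * ξ * t⁻¹ = (a * x * b⁻¹)⁻¹ * (a' * x' * b'⁻¹) := by
    calc _ = (a * x * b⁻¹)⁻¹ * (a * x * b⁻¹ * t * ξ) * t⁻¹ := by group
      _ = _ := by rw [heq]; group
  rw [e]
  exact ⟨[b, x⁻¹, a⁻¹, a', x', b'⁻¹], by
    simp [h.inv_mem_Y, h.R_Y ha, h.R_Y ha', h.R_Y hb, h.R_Y hb', h.X_Y hx, h.X_Y hx'],
    by simp, by simp [mul_assoc]⟩

theorem crossSep_translate_conj (h : CoreData X Q R Y Z v v' t β δ γ) :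
    CrossSep X ((· * t) '' (R * X * R⁻¹)) ((fun y => t * y * t⁻¹ * β y) '' (X \ {1})) := by
  apply CrossSep.of_mul_eq
  rintro _ ⟨g, hg, rfl⟩ _ ⟨y, ⟨hy, hy1⟩, rfl⟩ ξ hξ heq
  exact (h.β_ne y hy hy1 g hg ξ hξ heq).elim

theorem crossSep_translate_exit (h : CoreData X Q R Y Z v v' t β δ γ) :
    CrossSep X ((· * t) '' (R * X * R⁻¹))
      (Set.image2 (fun q y => q * y * t⁻¹ * γ q y) R X) := by
  apply CrossSep.of_mul_eq
  rintro _ ⟨g, hg, rfl⟩ _ ⟨q, hq, y, hy, rfl⟩ ξ hξ heq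
  beta_reduce at heq
  obtain ⟨a, ha, x, hx, b, hb, rfl⟩ := mem_mul_mul_inv.1 hg
  have hγ := h.R_Y (h.Q_R (h.γ_mem q hq y hy))
  refine (h.γ_sq_t q hq y hy ξ hξ
    (h.generic_t.sq_eq_one (d := (a * x * b⁻¹)⁻¹ * q * y) ?_ ?_ ?_)).elim
  · calc t * (ξ * (γ q y)⁻¹) * t = (a * x * b⁻¹)⁻¹ * (a * x * b⁻¹ * t * ξ) * (γ q y)⁻¹ * t := by
          group
      _ = _ := by rw [heq]; group
  · exact ⟨[ξ, (γ q y)⁻¹, b, x⁻¹, a⁻¹, q, y], by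
      simp [h.inv_mem_Y, h.R_Y ha, h.R_Y hq, h.R_Y hb, h.X_Y hx, h.X_Y hy, h.X_Y hξ, hγ],
      by simp, by simp [mul_assoc]⟩
  · exact ⟨[b, x⁻¹, a⁻¹, q, y, ξ, (γ q y)⁻¹], by
      simp [h.inv_mem_Y, h.R_Y ha, h.R_Y hq, h.R_Y hb, h.X_Y hx, h.X_Y hy, h.X_Y hξ, hγ],
      by simp, by simp [mul_assoc]⟩

theorem crossSep_translate_enter (h : CoreData X Q R Y Z v v' t β δ γ) :
    CrossSep X ((· * t) '' (R * X * R⁻¹))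
      (Set.image2 (fun q y => t * y * q⁻¹ * δ q) R X) := by
  apply CrossSep.of_mul_eq
  rintro _ ⟨g, hg, rfl⟩ _ ⟨q, hq, y, hy, rfl⟩ ξ hξ heq
  beta_reduce at heq
  obtain ⟨a, ha, x, hx, b, hb, rfl⟩ := mem_mul_mul_inv.1 hg
  have hδq := h.R_Y (h.δ_mem hq)
  have e := h.generic_t.eq_one_of_conj_mem (y * q⁻¹ * δ q * ξ⁻¹) ⟨[y, q⁻¹, δ q, ξ⁻¹], by
      simp [h.inv_mem_Y, h.R_Y hq, h.X_Y hy, h.X_Y hξ, hδq], by simp, by simp [mul_assoc]⟩ (by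
    have : t * (y * q⁻¹ * δ q * ξ⁻¹) * t⁻¹ = a * x * b⁻¹ := by
      calc _ = (t * y * q⁻¹ * δ q) * ξ⁻¹ * t⁻¹ := by group
        _ = _ := by rw [← heq]; group
    rw [this]
    exact ⟨[a, x, b⁻¹], by simp [h.inv_mem_Y, h.R_Y ha, h.R_Y hb, h.X_Y hx], by simp,
      by simp [mul_assoc]⟩)
  refine (h.inv_mul_δ_notMem hq (z := y⁻¹ * ξ) ⟨[y⁻¹, ξ], by simp [h.inv_mem y hy, hξ],
    by simp, by simp⟩ ?_).elim
  calc q⁻¹ * δ q = y⁻¹ * (y * q⁻¹ * δ q * ξ⁻¹) * ξ := by group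
    _ = y⁻¹ * ξ := by rw [e]; group

theorem crossSep_conj (h : CoreData X Q R Y Z v v' t β δ γ) :
    CrossSep X ((fun y => t * y * t⁻¹ * β y) '' (X \ {1}))
      ((fun y => t * y * t⁻¹ * β y) '' (X \ {1})) := by
  rintro _ ⟨y, ⟨hy, hy1⟩, rfl⟩ _ ⟨y', ⟨hy', hy1'⟩, rfl⟩ hξ
  beta_reduce at hξ ⊢
  have hβ := h.R_Y (h.Q_R (h.β_mem y hy hy1))
  have hβ' := h.R_Y (h.Q_R (h.β_mem y' hy' hy1'))
  obtain ⟨ξ, hξ, heq⟩ : ∃ ξ ∈ X, t * y * t⁻¹ * β y * ξ = t * y' * t⁻¹ * β y' :=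
    ⟨_, hξ, mul_inv_cancel_left _ _⟩
  have e := h.generic_t.eq_one_of_conj_mem (y⁻¹ * y') ⟨[y⁻¹, y'], by
      simp [h.inv_mem_Y, h.X_Y hy, h.X_Y hy'], by simp, by simp⟩ (by
    have : t * (y⁻¹ * y') * t⁻¹ = β y * ξ * (β y')⁻¹ := by
      calc _ = (t * y * t⁻¹)⁻¹ * (t * y' * t⁻¹ * β y') * (β y')⁻¹ := by group
        _ = _ := by rw [← heq]; group
    rw [this]
    exact ⟨[β y, ξ, (β y')⁻¹], by simp [h.inv_mem_Y, hβ, hβ', h.X_Y hξ], by simp,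
      by simp [mul_assoc]⟩)
  rw [inv_mul_eq_one.1 e]

theorem crossSep_conj_exit (h : CoreData X Q R Y Z v v' t β δ γ) :
    CrossSep X ((fun y => t * y * t⁻¹ * β y) '' (X \ {1}))
      (Set.image2 (fun q y => q * y * t⁻¹ * γ q y) R X) := by
  apply CrossSep.of_mul_eq
  rintro _ ⟨y', ⟨hy', hy1⟩, rfl⟩ _ ⟨q, hq, y, hy, rfl⟩ ξ hξ heq
  exact (h.γ_ne q hq y hy y' hy' hy1 ξ hξ heq).elim

theorem crossSep_conj_enter (h : CoreData X Q R Y Z v v' t β δ γ) :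
    CrossSep X ((fun y => t * y * t⁻¹ * β y) '' (X \ {1}))
      (Set.image2 (fun q y => t * y * q⁻¹ * δ q) R X) := by
  apply CrossSep.of_mul_eq
  rintro _ ⟨y', ⟨hy', hy1⟩, rfl⟩ _ ⟨q, hq, y, hy, rfl⟩ ξ hξ heq
  beta_reduce at heq
  have hβ := h.R_Y (h.Q_R (h.β_mem y' hy' hy1))
  have hδq := h.R_Y (h.δ_mem hq)
  refine (h.generic_t.notMem ⟨[β y', ξ, (δ q)⁻¹, q, y⁻¹, y'], by
    simp [h.inv_mem_Y, h.R_Y hq, h.X_Y hy, h.X_Y hy', h.X_Y hξ, hδq, hβ], by simp, ?_⟩).elim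
  have : β y' * ξ = t * y'⁻¹ * t⁻¹ * (t * y' * t⁻¹ * β y' * ξ) := by group
  rw [heq] at this
  simp only [List.prod_cons, List.prod_nil, ← mul_assoc, this]
  group

theorem crossSep_exit (h : CoreData X Q R Y Z v v' t β δ γ) :
    CrossSep X (Set.image2 (fun q y => q * y * t⁻¹ * γ q y) R X)
      (Set.image2 (fun q y => q * y * t⁻¹ * γ q y) R X) := by
  rintro _ ⟨q, hq, y, hy, rfl⟩ _ ⟨q', hq', y', hy', rfl⟩ hξ
  beta_reduce at hξ ⊢
  obtain ⟨ξ, hξ, heq⟩ : ∃ ξ ∈ X, q * y * t⁻¹ * γ q y * ξ = q' * y' * t⁻¹ * γ q' y' :=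
    ⟨_, hξ, mul_inv_cancel_left _ _⟩
  have hγ := h.R_Y (h.Q_R (h.γ_mem q hq y hy))
  have hγ' := h.R_Y (h.Q_R (h.γ_mem q' hq' y' hy'))
  have e := h.generic_t.eq_one_of_conj_mem (y⁻¹ * q⁻¹ * q' * y') ⟨[y⁻¹, q⁻¹, q', y'], by
      simp [h.inv_mem_Y, h.X_Y hy, h.X_Y hy', h.R_Y hq, h.R_Y hq'], by simp,
      by simp [mul_assoc]⟩ (by
    have : t * (y⁻¹ * q⁻¹ * q' * y') * t⁻¹ = γ q y * ξ * (γ q' y')⁻¹ := by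
      calc _ = t * (q * y)⁻¹ * (q' * y' * t⁻¹ * γ q' y') * (γ q' y')⁻¹ := by group
        _ = _ := by rw [← heq]; group
    rw [this]
    exact ⟨[γ q y, ξ, (γ q' y')⁻¹], by simp [h.inv_mem_Y, hγ, hγ', h.X_Y hξ], by simp,
      by simp [mul_assoc]⟩)
  have e' : q⁻¹ * q' = y * y'⁻¹ := by
    calc q⁻¹ * q' = y * (y⁻¹ * q⁻¹ * q' * y') * y'⁻¹ := by group
      _ = y * y'⁻¹ := by rw [e]; group
  obtain rfl : q = q' := h.crossSep_R q hq q' hq' (e' ▸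
    ⟨[y, y'⁻¹], by simp [hy, h.inv_mem y' hy'], by simp, by simp⟩)
  obtain rfl : y = y' := by simpa [eq_comm, mul_inv_eq_one] using e'
  rfl

theorem crossSep_exit_enter (h : CoreData X Q R Y Z v v' t β δ γ) :
    CrossSep X (Set.image2 (fun q y => q * y * t⁻¹ * γ q y) R X)
      (Set.image2 (fun q y => t * y * q⁻¹ * δ q) R X) := by
  apply CrossSep.of_mul_eq
  rintro _ ⟨q, hq, y, hy, rfl⟩ _ ⟨r, hr, x, hx, rfl⟩ ξ hξ heq
  beta_reduce at heq
  have hγQ := h.γ_mem q hq y hy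
  have hγsq := h.γ_sq_v q hq y hy
  have hγ := h.R_Y (h.Q_R hγQ)
  have hγZ := h.Q_Z hγQ
  have hδr := h.R_Y (h.δ_mem hr)
  have hz : x⁻¹ * y⁻¹ ∈ wordBall X 2 :=
    ⟨[x⁻¹, y⁻¹], by simp [h.inv_mem x hx, h.inv_mem y hy], by simp, by simp⟩
  have e := h.generic_t.mul_eq_one (c := y⁻¹ * q⁻¹) (d := γ q y * ξ * (δ r)⁻¹ * r * x⁻¹) (by
      calc _ = t * (q * y)⁻¹ * (t * x * r⁻¹ * δ r) * (δ r)⁻¹ * r * x⁻¹ := by group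
        _ = _ := by rw [← heq]; group)
    ⟨[y⁻¹, q⁻¹, γ q y, ξ, (δ r)⁻¹, r, x⁻¹], by
      simp [h.inv_mem_Y, h.R_Y hr, h.R_Y hq, h.X_Y hx, h.X_Y hy, h.X_Y hξ, hγ, hδr], by simp,
      by simp [mul_assoc]⟩
    ⟨[γ q y, ξ, (δ r)⁻¹, r, x⁻¹, y⁻¹, q⁻¹], by
      simp [h.inv_mem_Y, h.R_Y hr, h.R_Y hq, h.X_Y hx, h.X_Y hy, h.X_Y hξ, hγ, hδr], by simp,
      by simp [mul_assoc]⟩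
  replace e : q⁻¹ * γ q y * ξ * (δ r)⁻¹ * r * (x⁻¹ * y⁻¹) = 1 := by
    calc _ = y * (y⁻¹ * q⁻¹ * (γ q y * ξ * (δ r)⁻¹ * r * x⁻¹)) * y⁻¹ := by group
      _ = 1 := by rw [e]; group
  clear heq
  generalize γ q y = c at *
  have hxZ := h.X_Z hx
  have hyZ := h.X_Z hy
  have hξZ := h.X_Z hξ
  rcases h.R_cases r hr with rfl | hrQ
  · rw [h.δ_v] at e
    have hvZ := h.Q_Z h.v'_mem
    rcases h.R_cases q hq with rfl | hqQ
    · have e' : q * (x⁻¹ * y⁻¹) * q⁻¹ = v' * ξ⁻¹ * c⁻¹ := by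
        calc _ = v' * ξ⁻¹ * c⁻¹ * q * (q⁻¹ * c * ξ * v'⁻¹ * q * (x⁻¹ * y⁻¹)) * q⁻¹ := by group
          _ = _ := by rw [e]; group
      have e1 := h.generic_v.eq_one_of_conj_mem (x⁻¹ * y⁻¹)
        (wordBall_mono h.X_Z (by simp) hz) (by
          rw [e']
          exact ⟨[v', ξ⁻¹, c⁻¹], by simp [h.inv_mem_Z, *], by simp, by simp [mul_assoc]⟩)
      rw [e1] at e'
      have e2 : c⁻¹ * v' = ξ := by
        calc c⁻¹ * v' = c⁻¹ * (v' * ξ⁻¹ * c⁻¹) * c * ξ := by group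
          _ = ξ := by rw [← e']; group
      have e3 := h.sepX c hγQ v' h.v'_mem (by
        rw [e2]; exact subset_wordBall X (by simp) hξ)
      rw [← e2, e3]; group
    · refine (h.generic_v.notMem ⟨[v', ξ⁻¹, c⁻¹, q, y, x], by
        simp [h.inv_mem_Z, h.Q_Z hqQ, *], by simp, ?_⟩).elim
      calc _ = v' * ξ⁻¹ * c⁻¹ * q * y * x := by simp [mul_assoc]
        _ = v' * ξ⁻¹ * c⁻¹ * q * (q⁻¹ * c * ξ * v'⁻¹ * r * (x⁻¹ * y⁻¹)) * y * x := by
          rw [e]; group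
        _ = r := by group
  · rw [h.δ_Q r hrQ] at e
    have hrZ := h.Q_Z hrQ
    rcases h.R_cases q hq with rfl | hqQ
    · have e' : q * ((x⁻¹ * y⁻¹)⁻¹ * r⁻¹) * q = c * ξ := by
        calc _ = q * (q⁻¹ * c * ξ * q⁻¹ * r * (x⁻¹ * y⁻¹)) * (x⁻¹ * y⁻¹)⁻¹ * r⁻¹ * q := by
              rw [e]; group
          _ = _ := by group
      have m1 : (x⁻¹ * y⁻¹)⁻¹ * r⁻¹ * (c * ξ) ∈ wordBall Z 12 :=
        ⟨[y, x, r⁻¹, c, ξ], by simp [h.inv_mem_Z, *], by simp, by simp [mul_assoc]⟩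
      have m2 : (c * ξ) * ((x⁻¹ * y⁻¹)⁻¹ * r⁻¹) ∈ wordBall Z 12 :=
        ⟨[c, ξ, y, x, r⁻¹], by simp [h.inv_mem_Z, *], by simp, by simp [mul_assoc]⟩
      have e1 := h.generic_v.mul_eq_one e' m1 m2
      have e2 := h.generic_v.sq_eq_one e' m1 m2
      have e3 : r⁻¹ * c = x⁻¹ * y⁻¹ * ξ⁻¹ := by
        calc r⁻¹ * c = (x⁻¹ * y⁻¹) * ((x⁻¹ * y⁻¹)⁻¹ * r⁻¹ * (c * ξ)) * ξ⁻¹ := by group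
          _ = _ := by rw [e1]; group
      obtain rfl := h.sepX r hrQ c hγQ (by
        rw [e3]
        exact wordBall_mul hz (subset_wordBall X le_rfl (h.inv_mem ξ hξ)))
      exact (hγsq _ (wordBall_inv h.inv_mem hz) e2).elim
    · refine (h.generic_v.notMem ⟨[r, x⁻¹, y⁻¹, q⁻¹, c, ξ], by
        simp [h.inv_mem_Z, h.Q_Z hqQ, *], by simp, ?_⟩).elim
      calc _ = r * (x⁻¹ * y⁻¹) * (q⁻¹ * c * ξ * v⁻¹ * r * (x⁻¹ * y⁻¹)) * (x⁻¹ * y⁻¹)⁻¹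
              * r⁻¹ * v := by simp [mul_assoc]
        _ = v := by rw [e]; group

theorem enter_ne (h : CoreData X Q R Y Z v v' t β δ γ) {q y y' ξ : G} (hq : q ∈ Q)
    (hy : y ∈ X) (hy' : y' ∈ X) (hξ : ξ ∈ X) : y * q⁻¹ * v * ξ ≠ y' * v⁻¹ * v' := by
  intro heq
  have hqZ := h.Q_Z hq
  have hyZ := h.X_Z hy
  have hyZ' := h.X_Z hy'
  have hξZ := h.X_Z hξ
  have hvZ := h.Q_Z h.v'_mem
  refine h.v'_sq ξ (subset_wordBall X (by simp) hξ)
    (h.generic_v.sq_eq_one (d := q * y⁻¹ * y') ?_ ?_ ?_)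
  · calc v * (ξ * v'⁻¹) * v = q * y⁻¹ * (y * q⁻¹ * v * ξ) * v'⁻¹ * v := by group
      _ = _ := by rw [heq]; group
  · exact ⟨[ξ, v'⁻¹, q, y⁻¹, y'], by simp [h.inv_mem_Z, *], by simp, by simp [mul_assoc]⟩
  · exact ⟨[q, y⁻¹, y', ξ, v'⁻¹], by simp [h.inv_mem_Z, *], by simp, by simp [mul_assoc]⟩

theorem crossSep_enter (h : CoreData X Q R Y Z v v' t β δ γ) :
    CrossSep X (Set.image2 (fun q y => t * y * q⁻¹ * δ q) R X)
      (Set.image2 (fun q y => t * y * q⁻¹ * δ q) R X) := by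
  apply CrossSep.of_mul_eq
  rintro _ ⟨q, hq, y, hy, rfl⟩ _ ⟨r, hr, x, hx, rfl⟩ ξ hξ heq
  beta_reduce at heq
  replace heq : y * q⁻¹ * δ q * ξ = x * r⁻¹ * δ r := by
    apply mul_left_cancel (a := t)
    simpa only [mul_assoc] using heq
  have hxZ := h.X_Z hx
  have hyZ := h.X_Z hy
  have hξZ := h.X_Z hξ
  rcases h.R_cases r hr with rfl | hrQ <;> rcases h.R_cases q hq with rfl | hqQ
  · rw [h.δ_v] at heq
    have hvZ := h.Q_Z h.v'_mem
    have e := h.generic_v.eq_one_of_conj_mem (x⁻¹ * y)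
      ⟨[x⁻¹, y], by simp [h.inv_mem_Z, *], by simp, by simp⟩ (by
        have : q * (x⁻¹ * y) * q⁻¹ = v' * ξ⁻¹ * v'⁻¹ := by
          calc _ = q * x⁻¹ * (y * q⁻¹ * v' * ξ) * ξ⁻¹ * v'⁻¹ := by group
            _ = _ := by rw [heq]; group
        rw [this]
        exact ⟨[v', ξ⁻¹, v'⁻¹], by simp [h.inv_mem_Z, *], by simp, by simp [mul_assoc]⟩)
    obtain rfl := inv_mul_eq_one.1 e
    simpa using heq
  · rw [h.δ_v, h.δ_Q q hqQ] at heq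
    exact (h.enter_ne hqQ hy hx hξ heq).elim
  · rw [h.δ_v, h.δ_Q r hrQ] at heq
    refine (h.enter_ne hrQ hx hy (h.inv_mem ξ hξ) ?_).elim
    rw [← heq]; group
  · rw [h.δ_Q r hrQ, h.δ_Q q hqQ] at heq
    have hqZ := h.Q_Z hqQ
    have hrZ := h.Q_Z hrQ
    refine h.generic_v.eq_one_of_conj_mem ξ (subset_wordBall Z (by simp) hξZ) ?_
    have : v * ξ * v⁻¹ = q * y⁻¹ * x * r⁻¹ := by
      calc _ = q * y⁻¹ * (y * q⁻¹ * v * ξ) * v⁻¹ := by group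
        _ = _ := by rw [heq]; group
    rw [this]
    exact ⟨[q, y⁻¹, x, r⁻¹], by simp [h.inv_mem_Z, *], by simp, by simp [mul_assoc]⟩

end CoreData

end

section

variable {G : Type*} [Group G]

theorem Finset.exists_mem_forall_not_of_card_lt {α ι : Type*} {I : Finset ι} {Q : Finset α}
    {p : ι → α → Prop} (hc : I.card < Q.card)
    (h : ∀ i ∈ I, ∀ a ∈ Q, ∀ b ∈ Q, p i a → p i b → a = b) :
    ∃ q ∈ Q, ∀ i ∈ I, ¬ p i q := by
  by_contra! hcon
  obtain ⟨q, hq⟩ := Finset.card_pos.1 (hc.trans_le' (Nat.zero_le _))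
  have : Nonempty ι := ⟨(hcon q hq).choose⟩
  choose! f hfI hf using hcon
  obtain ⟨a, ha, b, hb, hab, e⟩ := Finset.exists_ne_map_eq_of_card_lt_of_maps_to hc hfI
  exact hab (h (f a) (hfI a ha) a ha b hb (hf a ha) (e ▸ hf b hb))

theorem CrossSep.mono_left {X X' P Q : Set G} (h : CrossSep X P Q) (hX : X' ⊆ X) :
    CrossSep X' P Q :=
  fun p hp q hq hpq => h p hp q hq (hX hpq)

theorem crossSep_insert {X P : Set G} {a : G} (hX : ∀ x ∈ X, x⁻¹ ∈ X) (h : CrossSep X P P)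
    (ha : ∀ p ∈ P, p⁻¹ * a ∉ X) : CrossSep X (insert a P) (insert a P) := by
  rintro p (rfl | hp) q (rfl | hq) hpq
  · rfl
  · exact (ha q hq (by simpa using hX _ hpq)).elim
  · exact (ha p hp hpq).elim
  · exact h p hp q hq hpq

theorem eq_of_sq_eq_one_of_sep {X Q Z : Set G} {v q r z w : G} {m : ℕ}
    (hX : ∀ x ∈ X, x⁻¹ ∈ X) (hZ : ∀ x ∈ Z, x⁻¹ ∈ Z)
    (hXZ : X ⊆ Z) (hQZ : Q ⊆ Z) (hQ : CrossSep (wordBall X (m + m)) Q Q)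
    (hv : IsGeneric (wordBall Z (m + 1 + (m + 1))) v) (hq : q ∈ Q) (hr : r ∈ Q)
    (hz : z ∈ wordBall X m) (hw : w ∈ wordBall X m)
    (h1 : v * (z * q⁻¹) * (v * (z * q⁻¹)) = 1) (h2 : v * (w * r⁻¹) * (v * (w * r⁻¹)) = 1) :
    q = r := by
  have mem {z q : G} (hq : q ∈ Q) (hz : z ∈ wordBall X m) : z * q⁻¹ ∈ wordBall Z (m + 1) :=
    wordBall_mul (wordBall_mono hXZ le_rfl hz)
      (wordBall_inv hZ (subset_wordBall Z le_rfl (hQZ hq)))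
  have e := hv.eq_of_sq_eq_one h1 h2 (wordBall_mul (mem hr hw) (wordBall_inv hZ (mem hq hz)))
    (wordBall_mul (wordBall_inv hZ (mem hr hw)) (mem hq hz))
  refine hQ q hq r hr ?_
  have : q⁻¹ * r = z⁻¹ * w := by
    calc _ = z⁻¹ * (z * q⁻¹) * r := by group
      _ = _ := by rw [e]; group
  rw [this]
  exact wordBall_mul (wordBall_inv hX hz) hw

theorem exists_coreData (hG : IsICC G) (X : Finset G) (hX1 : 1 ∈ X)
    (hXi : ∀ x ∈ X, x⁻¹ ∈ X) :
    ∃ (Q R Y Z : Set G) (v v' t : G) (β δ : G → G) (γ : G → G → G),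
      CoreData (X : Set G) Q R Y Z v v' t β δ γ ∧ R.Finite ∧ 1 ∈ R := by
  classical
  have := hG.infinite
  have hXi' : ∀ x ∈ (X : Set G), x⁻¹ ∈ (X : Set G) := hXi
  obtain ⟨Q, hQ1, hQc, hQ⟩ := exists_separated_finset
    (wordBall_finite X.finite_toSet 6) (fun x => wordBall_inv hXi') (X.card + 3)
  set Z : Set G := X ∪ Q ∪ (Q : Set G)⁻¹
  have hZfin : Z.Finite := (X.finite_toSet.union Q.finite_toSet).union Q.finite_toSet.inv
  have hZi : ∀ z, z⁻¹ ∈ Z ↔ z ∈ Z := by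
    have : ∀ z ∈ Z, z⁻¹ ∈ Z := by
      rintro z ((h | h) | h)
      exacts [.inl (.inl (hXi z h)), .inr (by simpa using h), .inl (.inr h)]
    exact fun z => ⟨fun h => by simpa using this _ h, this z⟩
  have hXZ : (X : Set G) ⊆ Z := fun x hx => .inl (.inl hx)
  have hQZ : (Q : Set G) ⊆ Z := fun x hx => .inl (.inr hx)
  obtain ⟨v, hv⟩ := hG.exists_isGeneric (wordBall_finite hZfin 12)
  set R : Set G := insert v Q
  have hRfin : R.Finite := Q.finite_toSet.insert v
  set Y : Set G := X ∪ R ∪ R⁻¹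
  have hYfin : Y.Finite := (X.finite_toSet.union hRfin).union hRfin.inv
  have hYi : ∀ z, z⁻¹ ∈ Y ↔ z ∈ Y := by
    have : ∀ z ∈ Y, z⁻¹ ∈ Y := by
      rintro z ((h | h) | h)
      exacts [.inl (.inl (hXi z h)), .inr (by simpa using h), .inl (.inr h)]
    exact fun z => ⟨fun h => by simpa using this _ h, this z⟩
  have hXY : (X : Set G) ⊆ Y := fun x hx => .inl (.inl hx)
  have hRY : R ⊆ Y := fun x hx => .inl (.inr hx)
  have hQR : (Q : Set G) ⊆ R := Set.subset_insert _ _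
  obtain ⟨t, ht⟩ := hG.exists_isGeneric (wordBall_finite hYfin 12)
  have invV : ∀ a ∈ Q, ∀ b ∈ Q,
      (∃ z ∈ wordBall (X : Set G) 2, v * (z * a⁻¹) * (v * (z * a⁻¹)) = 1) →
      (∃ z ∈ wordBall (X : Set G) 2, v * (z * b⁻¹) * (v * (z * b⁻¹)) = 1) → a = b := by
    rintro a ha b hb ⟨z, hz, h1⟩ ⟨w, hw, h2⟩
    exact eq_of_sq_eq_one_of_sep hXi' (fun x => (hZi x).2) hXZ hQZ
      (hQ.mono_left (wordBall_mono subset_rfl (by simp)))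
      ⟨fun h => hv.notMem (wordBall_mono subset_rfl (by simp) h), fun a ha h =>
        hv.eq_one_of_conj_mem a (wordBall_mono subset_rfl (by simp) ha)
          (wordBall_mono subset_rfl (by simp) h)⟩ ha hb hz hw h1 h2
  have invT : ∀ a ∈ Q, ∀ b ∈ Q,
      (∃ ξ ∈ X, t * (ξ * a⁻¹) * (t * (ξ * a⁻¹)) = 1) →
      (∃ ξ ∈ X, t * (ξ * b⁻¹) * (t * (ξ * b⁻¹)) = 1) → a = b := by
    rintro a ha b hb ⟨z, hz, h1⟩ ⟨w, hw, h2⟩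
    exact eq_of_sq_eq_one_of_sep (m := 1) hXi' (fun x => (hYi x).2) hXY (hQR.trans hRY)
      (hQ.mono_left (wordBall_mono subset_rfl (by simp)))
      ⟨fun h => ht.notMem (wordBall_mono subset_rfl (by simp) h), fun a ha h =>
        ht.eq_one_of_conj_mem a (wordBall_mono subset_rfl (by simp) ha)
          (wordBall_mono subset_rfl (by simp) h)⟩ ha hb (subset_wordBall (X : Set G) le_rfl hz)
      (subset_wordBall (X : Set G) le_rfl hw) h1 h2
  have sep2 : ∀ a ∈ Q, ∀ b ∈ Q, ∀ ξ ∈ X, ∀ η ∈ X, a⁻¹ * b = ξ⁻¹ * η → a = b := by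
    intro a ha b hb ξ hξ η hη e
    refine hQ a ha b hb ?_
    rw [e]
    exact ⟨[ξ⁻¹, η], by simp [hXi ξ hξ, hη], by simp, by simp⟩
  obtain ⟨v', hv', hv'sq⟩ := Finset.exists_mem_forall_not_of_card_lt (I := {()}) (Q := Q)
    (p := fun _ a => ∃ z ∈ wordBall (X : Set G) 2, v * (z * a⁻¹) * (v * (z * a⁻¹)) = 1)
    (by simp; omega) (fun _ _ => invV)
  have hβ : ∀ y : G, ∃ b ∈ Q, ∀ g ∈ R * X * R⁻¹, ∀ ξ ∈ X, g * t * ξ ≠ t * y * t⁻¹ * b := by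
    intro y
    obtain ⟨b, hb, h⟩ := Finset.exists_mem_forall_not_of_card_lt (I := {()}) (Q := Q)
      (p := fun _ b => ∃ g ∈ R * X * R⁻¹, ∃ ξ ∈ X, g * t * ξ = t * y * t⁻¹ * b)
      (by simp; omega) (by
        rintro - - b hb c hc ⟨g, hg, ξ, hξ, e⟩ ⟨g', hg', η, hη, e'⟩
        obtain ⟨p, hp, x, hx, q, hq, rfl⟩ := mem_mul_mul_inv.1 hg
        obtain ⟨p', hp', x', hx', q', hq', rfl⟩ := mem_mul_mul_inv.1 hg'
        have hbY := hRY (hQR hb)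
        have hcY := hRY (hQR hc)
        have e1 := ht.eq_one_of_conj_mem (ξ * b⁻¹ * c * η⁻¹) ⟨[ξ, b⁻¹, c, η⁻¹], by
            simp [hYi, hXY hξ, hXY hη, hbY, hcY], by simp, by simp [mul_assoc]⟩ (by
          have : t * (ξ * b⁻¹ * c * η⁻¹) * t⁻¹ = (p * x * q⁻¹)⁻¹ * (p' * x' * q'⁻¹) := by
            calc _ = (p * x * q⁻¹)⁻¹ * (p * x * q⁻¹ * t * ξ) * b⁻¹ * (t * y * t⁻¹)⁻¹ *
                    (t * y * t⁻¹ * c) * η⁻¹ * t⁻¹ := by group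
              _ = _ := by rw [e, ← e']; group
          rw [this]
          exact ⟨[q, x⁻¹, p⁻¹, p', x', q'⁻¹], by
            simp [hYi, hXY hx, hXY hx', hRY hp, hRY hp', hRY hq, hRY hq'], by simp,
            by simp [mul_assoc]⟩)
        refine sep2 b hb c hc ξ hξ η hη ?_
        calc b⁻¹ * c = ξ⁻¹ * (ξ * b⁻¹ * c * η⁻¹) * η := by group
          _ = _ := by rw [e1]; group)
    exact ⟨b, hb, fun g hg ξ hξ e => h () (by simp) ⟨g, hg, ξ, hξ, e⟩⟩
  choose β hβQ hβ using hβ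
  have hγ : ∀ q y : G, ∃ c ∈ Q,
      (∀ z ∈ wordBall (X : Set G) 2, v * (z * c⁻¹) * (v * (z * c⁻¹)) ≠ 1) ∧
      (∀ ξ ∈ X, t * (ξ * c⁻¹) * (t * (ξ * c⁻¹)) ≠ 1) ∧
      ∀ y' ∈ X, ∀ ξ ∈ X, t * y' * t⁻¹ * β y' * ξ ≠ q * y * t⁻¹ * c := by
    intro q y
    obtain ⟨c, hc, h⟩ := Finset.exists_mem_forall_not_of_card_lt
      (I := Finset.insertNone (Finset.insertNone X)) (Q := Q)
      (p := fun i c => match i with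
        | none => ∃ z ∈ wordBall (X : Set G) 2, v * (z * c⁻¹) * (v * (z * c⁻¹)) = 1
        | some none => ∃ ξ ∈ X, t * (ξ * c⁻¹) * (t * (ξ * c⁻¹)) = 1
        | some (some y') => ∃ ξ ∈ X, t * y' * t⁻¹ * β y' * ξ = q * y * t⁻¹ * c)
      (by simp only [Finset.card_insertNone]; omega) (by
        rintro (_ | _ | y') -
        · exact invV
        · exact invT
        · rintro a ha b hb ⟨ξ, hξ, e⟩ ⟨η, hη, e'⟩
          refine sep2 a ha b hb ξ hξ η hη ?_
          calc a⁻¹ * b = (q * y * t⁻¹ * a)⁻¹ * (q * y * t⁻¹ * b) := by group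
            _ = _ := by rw [← e, ← e']; group)
    refine ⟨c, hc, fun z hz e => h none (by simp) ⟨z, hz, e⟩,
      fun ξ hξ e => h (some none) (by simp) ⟨ξ, hξ, e⟩,
      fun y' hy' ξ hξ e => h (some (some y')) (by simp [hy']) ⟨ξ, hξ, e⟩⟩
  choose γ hγQ hγv hγt hγ using hγ
  have hvQ : v ∉ Q := fun h => hv.notMem (subset_wordBall Z (by simp) (hQZ h))
  refine ⟨Q, R, Y, Z, v, v', t, β, fun q => if q = v then v' else v, γ, ?_, hRfin, hQR hQ1⟩
  exact
    { one_mem := hX1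
      sepX := hQ.mono_left (wordBall_mono subset_rfl (by simp))
      inv_mem := hXi
      inv_mem_Y := hYi
      inv_mem_Z := hZi
      X_Y := hXY
      X_Z := hXZ
      Q_Z := hQZ
      R_Y := hRY
      Q_R := hQR
      v_R := Set.mem_insert _ _
      R_cases := fun r hr => hr
      generic_v := hv
      generic_t := ht
      v'_mem := hv'
      v'_sq := fun z hz e => hv'sq () (by simp) ⟨z, hz, e⟩
      δ_v := if_pos rfl
      δ_Q := fun q hq => if_neg fun e : q = v => hvQ (e ▸ hq)
      β_mem := fun y _ _ => hβQ y
      β_ne := fun y _ _ => hβ y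
      γ_mem := fun q _ y _ => hγQ q y
      γ_sq_v := fun q _ y _ => hγv q y
      γ_sq_t := fun q _ y _ => hγt q y
      γ_ne := fun q _ y _ y' hy' _ => hγ q y y' hy' }

/-- A finite separated set `P` together with a finite separated set `W` such that every `k` with
`k P` close to `P` moves some point of `W` into `P`. -/
theorem exists_core (hG : IsICC G) (X : Finset G) (hX1 : 1 ∈ X) (hXi : ∀ x ∈ X, x⁻¹ ∈ X) :
    ∃ P W : Set G, P.Finite ∧ W.Finite ∧ 1 ∈ P ∧ CrossSep (X : Set G) P P ∧
      CrossSep (X : Set G) W W ∧ ∀ k ∈ P * X * P⁻¹, ∃ w ∈ W, k * w ∈ P := by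
  obtain ⟨Q, R, Y, Z, v, v', t, β, δ, γ, h, hRfin, hR1⟩ := exists_coreData hG X hX1 hXi
  have hXi' := h.inv_mem
  have hXfin := X.finite_toSet
  have h12 := h.crossSep_translate_conj
  have h13 := h.crossSep_translate_exit
  have h14 := h.crossSep_translate_enter
  have h23 := h.crossSep_conj_exit
  have h24 := h.crossSep_conj_enter
  have h34 := h.crossSep_exit_enter
  refine ⟨insert t R, ((· * t) '' (R * X * R⁻¹)) ∪ ((fun y => t * y * t⁻¹ * β y) '' (X \ {1})) ∪
    (Set.image2 (fun q y => q * y * t⁻¹ * γ q y) R X) ∪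
    (Set.image2 (fun q y => t * y * q⁻¹ * δ q) R X), hRfin.insert t, ?_, .inr hR1, ?_, ?_, ?_⟩
  · refine (((((hRfin.mul hXfin).mul hRfin.inv).image _).union (hXfin.sdiff.image _)).union
      (hRfin.image2 _ hXfin)).union (hRfin.image2 _ hXfin)
  · refine crossSep_insert hXi' (h.crossSep_R.mono_left (subset_wordBall _ (by simp))) ?_
    intro r hr hrt
    refine h.generic_t.notMem ⟨[r, r⁻¹ * t], ?_, by simp, by simp⟩
    simp [h.R_Y hr, h.X_Y hrt]
  · refine (((h.crossSep_translate.union_left (h12.symm hXi')).union_left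
        (h13.symm hXi')).union_left (h14.symm hXi')).union_right
      (((h12.union_left h.crossSep_conj).union_left
        (h23.symm hXi')).union_left (h24.symm hXi')) |>.union_right
      (((h13.union_left h23).union_left h.crossSep_exit).union_left (h34.symm hXi'))
      |>.union_right (((h14.union_left h24).union_left h34).union_left h.crossSep_enter)
  · intro k hk
    obtain ⟨p, hp, x, hx, q, hq, rfl⟩ := mem_mul_mul_inv.1 hk
    have hxi := hXi' x hx
    rcases hp with rfl | hp <;> rcases hq with rfl | hq
    · by_cases hx1 : x = 1
      · refine ⟨_, .inl (.inl (.inl ⟨1, ?_, rfl⟩)), .inl (by simp [hx1])⟩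
        exact mem_mul_mul_inv.2 ⟨1, hR1, 1, hX1, 1, hR1, by simp⟩
      · refine ⟨_, .inl (.inl (.inr ⟨x⁻¹, ⟨hxi, by simpa using hx1⟩, rfl⟩)), .inr ?_⟩
        convert h.Q_R (h.β_mem x⁻¹ hxi (by simpa using hx1)) using 1
        group
    · refine ⟨_, .inl (.inr ⟨q, hq, x⁻¹, hxi, rfl⟩), .inr ?_⟩
      convert h.Q_R (h.γ_mem q hq x⁻¹ hxi) using 1
      group
    · refine ⟨_, .inr ⟨p, hp, x⁻¹, hxi, rfl⟩, .inr ?_⟩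
      convert h.δ_mem hp using 1
      group
    · refine ⟨_, .inl (.inl (.inl ⟨q * x⁻¹ * p⁻¹, ?_, rfl⟩)), .inl (by group)⟩
      exact mem_mul_mul_inv.2 ⟨q, hq, x⁻¹, hxi, p, hp, rfl⟩

end

section

variable {G : Type*} [Group G]

/-- Finite patterns `P` and `W'` such that perturbing either of them by a nearby copy of `P` still
leaves a common point with a translate of `W`. -/
theorem exists_patterns (hG : IsICC G) (X : Finset G) (hX1 : 1 ∈ X) (hXi : ∀ x ∈ X, x⁻¹ ∈ X) :
    ∃ P W W' : Set G, P.Finite ∧ W'.Finite ∧ 1 ∈ P ∧ W.Nonempty ∧ W ⊆ W' ∧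
      CrossSep (X : Set G) P P ∧ CrossSep (X : Set G) W' W' ∧
      (∀ k ∈ P * X * P⁻¹, ∃ w ∈ W, k * w ∈ P) ∧
      ∀ k ∈ W' * X * P⁻¹, ∃ w ∈ W, k * w ∈ W' := by
  obtain ⟨P, V, hPfin, hVfin, hP1, hP, hV, hPV⟩ := exists_core hG X hX1 hXi
  have hXi' : ∀ x ∈ (X : Set G), x⁻¹ ∈ (X : Set G) := hXi
  have hXfin := X.finite_toSet
  have sym (A : Set G) : ∀ z, z⁻¹ ∈ A ∪ A⁻¹ ↔ z ∈ A ∪ A⁻¹ := fun z => by simp [or_comm]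
  set Z : Set G := (X ∪ P ∪ V) ∪ (X ∪ P ∪ V)⁻¹ 
  have hZi : ∀ z, z⁻¹ ∈ Z ↔ z ∈ Z := sym _
  have hZfin : Z.Finite := by
    have := (hXfin.union hPfin).union hVfin
    exact this.union this.inv
  have hXZ : (X : Set G) ⊆ Z := fun x hx => .inl (.inl (.inl hx))
  have hPZ : P ⊆ Z := fun x hx => .inl (.inl (.inr hx))
  have hVZ : V ⊆ Z := fun x hx => .inl (.inr hx)
  obtain ⟨f, hf⟩ := hG.exists_isGeneric (wordBall_finite hZfin 12)
  set Y : Set G := insert f Z ∪ (insert f Z)⁻¹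
  have hYi : ∀ z, z⁻¹ ∈ Y ↔ z ∈ Y := sym _
  have hYfin : Y.Finite := (hZfin.insert f).union (hZfin.insert f).inv
  have hZY : Z ⊆ Y := fun x hx => .inl (.inr hx)
  have hfY : f ∈ Y := .inl (.inl rfl)
  obtain ⟨e, he⟩ := hG.exists_isGeneric (wordBall_finite hYfin 12)
  have hXY := hXZ.trans hZY
  have hPY := hPZ.trans hZY
  set K : Set G := insert f V
  have hKY : K ⊆ Y := Set.insert_subset hfY (hVZ.trans hZY)
  have hKfin : K.Finite := hVfin.insert f
  set A : Set G := insert e K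
  set B : Set G := Set.image2 (fun k p => k * e * p) ((K * X * P⁻¹) \ {1}) P
  set C : Set G := Set.image2 (fun c p => e * c * f * p) (X * P⁻¹) P
  have sepK : CrossSep (X : Set G) K K := by
    refine crossSep_insert hXi' hV fun w hw h => hf.notMem ⟨[w, w⁻¹ * f], ?_, by simp, by simp⟩
    simp [hVZ hw, hXZ h]
  have sepAA : CrossSep (X : Set G) A A := by
    refine crossSep_insert hXi' sepK fun w hw h => he.notMem ⟨[w, w⁻¹ * e], ?_, by simp, by simp⟩
    simp [hKY hw, hXY h]
  have sepAB : CrossSep (X : Set G) A B := by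
    apply CrossSep.of_mul_eq
    rintro w hw _ ⟨k, ⟨hk, hk1⟩, p, hp, rfl⟩ ξ hξ h
    beta_reduce at h
    obtain ⟨a, ha, x, hx, q, hq, rfl⟩ := mem_mul_mul_inv.1 hk
    have hpY := hPY hp
    have hqY := hPY hq
    have haY := hKY ha
    have hxY := hXY hx
    have hξY := hXY hξ
    rcases hw with rfl | hw
    · have e1 := he.eq_one_of_conj_mem (ξ * p⁻¹) ⟨[ξ, p⁻¹], by simp [hYi, hpY, hξY],
        by simp, by simp⟩ (by
        have : w * (ξ * p⁻¹) * w⁻¹ = a * x * q⁻¹ := by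
          calc _ = (w * ξ) * p⁻¹ * w⁻¹ := by group
            _ = _ := by rw [h]; group
        rw [this]
        exact ⟨[a, x, q⁻¹], by simp [hYi, hqY, haY, hxY], by simp, by simp [mul_assoc]⟩)
      refine (hk1 ?_).elim
      calc a * x * q⁻¹ = (a * x * q⁻¹ * w * p) * p⁻¹ * w⁻¹ := by group
        _ = w * (ξ * p⁻¹) * w⁻¹ := by rw [← h]; group
        _ = 1 := by rw [e1]; group
    · refine (he.notMem ⟨[q, x⁻¹, a⁻¹, w, ξ, p⁻¹],
        by simp [hYi, hKY hw, hpY, hqY, haY, hxY, hξY], by simp, ?_⟩).elim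
      calc _ = (a * x * q⁻¹)⁻¹ * (w * ξ) * p⁻¹ := by simp [mul_assoc]
        _ = e := by rw [h]; group
  have sepAC : CrossSep (X : Set G) A C := by
    apply CrossSep.of_mul_eq
    rintro w hw _ ⟨_, ⟨x, hx, q, hq, rfl⟩, p, hp, rfl⟩ ξ hξ h
    beta_reduce at h
    have hqZ : q ∈ Z := (hZi _).1 (hPZ hq)
    rcases hw with rfl | hw
    · refine (hf.notMem ⟨[q⁻¹, x⁻¹, ξ, p⁻¹], by
        simp [hZi, hXZ hξ, hXZ hx, hPZ hp, hqZ], by simp, ?_⟩).elim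
      calc _ = q⁻¹ * x⁻¹ * w⁻¹ * (w * ξ) * p⁻¹ := by simp [mul_assoc]
        _ = f := by rw [h]; group
    · refine (he.notMem ⟨[w, ξ, p⁻¹, f⁻¹, q⁻¹, x⁻¹], by
        simp [hYi, hKY hw, hXY hξ, hXY hx, hPY hp, hZY hqZ, hfY], by simp, ?_⟩).elim
      calc _ = (w * ξ) * p⁻¹ * f⁻¹ * q⁻¹ * x⁻¹ := by simp [mul_assoc]
        _ = e := by rw [h]; group
  have eq_one {p p' ξ : G} (hp : p ∈ P) (hp' : p' ∈ P) (hξ : ξ ∈ X) (h : p * ξ * p'⁻¹ = 1) :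
      ξ = 1 := by
    have h' : p⁻¹ * p' = ξ := by
      calc p⁻¹ * p' = p⁻¹ * (p * ξ * p'⁻¹)⁻¹ * (p * ξ) := by group
        _ = ξ := by rw [h]; group
    obtain rfl := hP p hp p' hp' (h' ▸ hξ)
    simpa using h'.symm
  have sepBB : CrossSep (X : Set G) B B := by
    apply CrossSep.of_mul_eq
    rintro _ ⟨k, ⟨hk, -⟩, p, hp, rfl⟩ _ ⟨k', ⟨hk', -⟩, p', hp', rfl⟩ ξ hξ h
    beta_reduce at h
    obtain ⟨a, ha, x, hx, q, hq, rfl⟩ := mem_mul_mul_inv.1 hk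
    obtain ⟨a', ha', x', hx', q', hq', rfl⟩ := mem_mul_mul_inv.1 hk'
    refine eq_one hp hp' hξ (he.eq_one_of_conj_mem _ ⟨[p, ξ, p'⁻¹], by
      simp [hYi, hXY hξ, hPY hp, hPY hp'], by simp, by simp [mul_assoc]⟩ ?_)
    have : e * (p * ξ * p'⁻¹) * e⁻¹ = (a * x * q⁻¹)⁻¹ * (a' * x' * q'⁻¹) := by
      calc _ = (a * x * q⁻¹)⁻¹ * (a * x * q⁻¹ * e * p * ξ) * p'⁻¹ * e⁻¹ := by group
        _ = _ := by rw [h]; group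
    rw [this]
    exact ⟨[q, x⁻¹, a⁻¹, a', x', q'⁻¹], by
      simp [hYi, hXY hx, hXY hx', hPY hq, hPY hq', hKY ha, hKY ha'], by simp,
      by simp [mul_assoc]⟩
  have sepBC : CrossSep (X : Set G) B C := by
    apply CrossSep.of_mul_eq
    rintro _ ⟨k, ⟨hk, hk1⟩, p, hp, rfl⟩ _ ⟨_, ⟨x', hx', q', hq', rfl⟩, p', hp', rfl⟩ ξ hξ h
    beta_reduce at h
    obtain ⟨a, ha, x, hx, q, hq, rfl⟩ := mem_mul_mul_inv.1 hk
    have hq'Y : q' ∈ Y := (hYi _).1 (hPY hq')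
    have h1 : e * (x' * q' * f * p' * ξ⁻¹ * p⁻¹) * e⁻¹ = a * x * q⁻¹ := by
      calc _ = (e * (x' * q') * f * p') * ξ⁻¹ * p⁻¹ * e⁻¹ := by group
        _ = _ := by rw [← h]; group
    have h2 := he.eq_one_of_conj_mem (x' * q' * f * p' * ξ⁻¹ * p⁻¹) ⟨[x', q', f, p', ξ⁻¹, p⁻¹], by
      simp [hYi, hXY hx', hq'Y, hfY, hXY hξ, hPY hp, hPY hp'], by simp, by simp [mul_assoc]⟩ (by
      rw [h1]
      exact ⟨[a, x, q⁻¹], by simp [hYi, hXY hx, hPY hq, hKY ha], by simp, by simp [mul_assoc]⟩)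
    rw [h2] at h1
    exact (hk1 (by rw [← h1]; simp)).elim
  have sepCC : CrossSep (X : Set G) C C := by
    apply CrossSep.of_mul_eq
    rintro _ ⟨_, ⟨x, hx, q, hq, rfl⟩, p, hp, rfl⟩ _ ⟨_, ⟨x', hx', q', hq', rfl⟩, p', hp', rfl⟩
      ξ hξ h
    beta_reduce at h
    have hqZ : q ∈ Z := (hZi _).1 (hPZ hq)
    have hq'Z : q' ∈ Z := (hZi _).1 (hPZ hq')
    refine eq_one hp hp' hξ (hf.eq_one_of_conj_mem _ ⟨[p, ξ, p'⁻¹], by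
      simp [hZi, hXZ hξ, hPZ hp, hPZ hp'], by simp, by simp [mul_assoc]⟩ ?_)
    have : f * (p * ξ * p'⁻¹) * f⁻¹ = q⁻¹ * x⁻¹ * x' * q' := by
      calc _ = (e * (x * q))⁻¹ * (e * (x * q) * f * p * ξ) * p'⁻¹ * f⁻¹ := by group
        _ = _ := by rw [h]; group
    rw [this]
    exact ⟨[q⁻¹, x⁻¹, x', q'], by simp [hZi, hXZ hx, hXZ hx', hqZ, hq'Z], by simp,
      by simp [mul_assoc]⟩
  have hVA : V ⊆ A := (Set.subset_insert _ _).trans (Set.subset_insert _ _)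
  refine ⟨P, A, A ∪ B ∪ C, hPfin, ?_, hP1, ⟨e, .inl rfl⟩, fun w hw => .inl (.inl hw), hP,
    ?_, ?_, ?_⟩
  · exact ((hKfin.insert e).union
      ((((hKfin.mul hXfin).mul hPfin.inv).sdiff).image2 _ hPfin)).union
        ((hXfin.mul hPfin.inv).image2 _ hPfin)
  · exact ((sepAA.union_left (sepAB.symm hXi')).union_left (sepAC.symm hXi')).union_right
      ((sepAB.union_left sepBB).union_left (sepBC.symm hXi')) |>.union_right
      ((sepAC.union_left sepBC).union_left sepCC)
  · intro k hk
    obtain ⟨w, hw, h⟩ := hPV k hk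
    exact ⟨w, hVA hw, h⟩
  · intro k hk
    obtain ⟨w, hw, x, hx, q, hq, rfl⟩ := mem_mul_mul_inv.1 hk
    rcases hw with ((rfl | hw) | ⟨k, hkK, p, hp, rfl⟩) | ⟨c, hc, p, hp, rfl⟩
    · exact ⟨f, .inr (.inl rfl), .inr ⟨x * q⁻¹, Set.mul_mem_mul hx (Set.inv_mem_inv.2 hq), 1, hP1,
        by group⟩⟩
    · by_cases h1 : w * x * q⁻¹ = 1
      · exact ⟨e, .inl rfl, .inl (.inl (by rw [h1, one_mul]; exact .inl rfl))⟩
      · exact ⟨e, .inl rfl, .inl (.inr ⟨w * x * q⁻¹, ⟨mem_mul_mul_inv.2 ⟨w, hw, x, hx, q, hq, rfl⟩,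
          h1⟩, 1, hP1, by simp⟩)⟩
    · obtain ⟨w, hw, h⟩ := hPV (p * x * q⁻¹) (mem_mul_mul_inv.2 ⟨p, hp, x, hx, q, hq, rfl⟩)
      exact ⟨w, hVA hw, .inl (.inr ⟨k, hkK, _, h, by group⟩)⟩
    · obtain ⟨w, hw, h⟩ := hPV (p * x * q⁻¹) (mem_mul_mul_inv.2 ⟨p, hp, x, hx, q, hq, rfl⟩)
      exact ⟨w, hVA hw, .inr ⟨c, hc, _, h, by group⟩⟩

end

/-- `M` is a maximal `Z`-separated set, and `B` is a maximal `U`-separated set among those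
disjoint from `M * D`. -/
structure IsMarkerPair {G : Type*} [Group G] (Z D U M B : Set G) : Prop where
  sep_left : CrossSep Z M M
  cover_left : ∀ g, g ∈ M * Z
  sep_right : CrossSep U B B
  disjoint : ∀ b ∈ B, b ∉ M * D
  cover_right : ∀ g, g ∈ B * U ∨ g ∈ M * D

/-- The configurations that place a copy of `V` at each point of `M` and a copy of `P` at each
point of `B`, for the marker pairs `(M, B)`. -/
def markerShift {G : Type*} [Group G] (Z D U V P : Set G) : Set (G → Fin 2) :=
  {s | ∃ M B, IsMarkerPair Z D U M B ∧ ∀ g, s g = 1 ↔ g ∈ M * V ∨ g ∈ B * P}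

section

variable {G : Type*} [Group G]

theorem Set.mem_mul_iff_exists_inv_mul_mem {M W : Set G} {g : G} :
    g ∈ M * W ↔ ∃ m ∈ M, m⁻¹ * g ∈ W :=
  ⟨fun ⟨m, hm, w, hw, e⟩ => ⟨m, hm, by simpa [← e] using hw⟩,
    fun ⟨m, hm, h⟩ => ⟨m, hm, _, h, mul_inv_cancel_left _ _⟩⟩

theorem Set.mem_mul_iff_exists_mul_inv_mem {M W : Set G} {g : G} :
    g ∈ M * W ↔ ∃ w ∈ W, g * w⁻¹ ∈ M :=
  ⟨fun ⟨m, hm, w, hw, e⟩ => ⟨w, hw, by simpa [← e] using hm⟩,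
    fun ⟨w, hw, h⟩ => ⟨_, h, w, hw, inv_mul_cancel_right _ _⟩⟩

theorem exists_maximal_crossSep {Z N A : Set G} (hZ1 : 1 ∈ Z) (hZ : ∀ z ∈ Z, z⁻¹ ∈ Z)
    (hA : CrossSep Z A A) (hAN : ∀ a ∈ A, a ∉ N) :
    ∃ B, A ⊆ B ∧ CrossSep Z B B ∧ (∀ b ∈ B, b ∉ N) ∧ ∀ g, g ∈ B * Z ∨ g ∈ N := by
  obtain ⟨B, hAB, hB⟩ := zorn_subset_nonempty {B | CrossSep Z B B ∧ ∀ b ∈ B, b ∉ N} (by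
    intro c hc hchain hne
    refine ⟨⋃₀ c, ⟨?_, ?_⟩, fun s hs => Set.subset_sUnion_of_mem hs⟩
    · rintro p ⟨s, hs, hp⟩ q ⟨t, ht, hq⟩ h
      rcases hchain.total hs ht with hst | hst
      exacts [(hc ht).1 p (hst hp) q hq h, (hc hs).1 p hp q (hst hq) h]
    · rintro b ⟨s, hs, hb⟩
      exact (hc hs).2 b hb) A ⟨hA, hAN⟩
  refine ⟨B, hAB, hB.prop.1, hB.prop.2, fun g => or_iff_not_imp_right.2 fun hg => ?_⟩
  by_contra hcon
  rw [Set.mem_mul_iff_exists_inv_mul_mem] at hcon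
  push Not at hcon
  have : insert g B ⊆ B := hB.le_of_ge ⟨crossSep_insert hZ hB.prop.1 hcon, by
    rintro b (rfl | hb)
    exacts [hg, hB.prop.2 b hb]⟩ (Set.subset_insert g B)
  exact hcon g (this (Set.mem_insert g B)) (by simpa using hZ1)

theorem isMarkerPair_iff {Z D U M B : Set G} : IsMarkerPair Z D U M B ↔
    CrossSep Z M M ∧ (∀ g, g ∈ M * Z) ∧ CrossSep U B B ∧ (∀ b ∈ B, b ∉ M * D) ∧
      ∀ g, g ∈ B * U ∨ g ∈ M * D :=
  ⟨fun h => ⟨h.1, h.2, h.3, h.4, h.5⟩, fun h => ⟨h.1, h.2.1, h.2.2.1, h.2.2.2.1, h.2.2.2.2⟩⟩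

theorem IsMarkerPair.exists_extension {Z D U A C : Set G} (hZ1 : 1 ∈ Z)
    (hZ : ∀ z ∈ Z, z⁻¹ ∈ Z) (hU1 : 1 ∈ U) (hU : ∀ z ∈ U, z⁻¹ ∈ U) (hA : CrossSep Z A A)
    (hC : CrossSep U C C)
    (hAC : ∀ M, A ⊆ M → CrossSep Z M M → ∀ c ∈ C, c ∉ M * D) :
    ∃ M B, A ⊆ M ∧ C ⊆ B ∧ IsMarkerPair Z D U M B := by
  obtain ⟨M, hAM, hM, -, hM'⟩ := exists_maximal_crossSep hZ1 hZ hA (N := ∅) (by simp)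
  obtain ⟨B, hCB, hB, hBM, hB'⟩ := exists_maximal_crossSep hU1 hU hC (hAC M hAM hM)
  exact ⟨M, B, hAM, hCB, hM, fun g => (hM' g).resolve_right id, hB, hBM, hB'⟩

theorem IsMarkerPair.translate {Z D U M B : Set G} (h : IsMarkerPair Z D U M B) (g : G) :
    IsMarkerPair Z D U (g • M) (g • B) := by
  have sep {Z M : Set G} (h : CrossSep Z M M) : CrossSep Z (g • M) (g • M) := by
    rintro _ ⟨p, hp, rfl⟩ _ ⟨q, hq, rfl⟩ hpq
    rw [h p hp q hq (by simpa [mul_assoc] using hpq)]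
  have mem {M W : Set G} {x : G} : x ∈ g • M * W ↔ g⁻¹ * x ∈ M * W := by
    rw [smul_mul_assoc, Set.mem_smul_set_iff_inv_smul_mem, smul_eq_mul]
  refine ⟨sep h.sep_left, fun x => mem.2 (h.cover_left _), sep h.sep_right, ?_, fun x => ?_⟩
  · rintro _ ⟨b, hb, rfl⟩ hm
    exact h.disjoint b hb (by simpa using mem.1 hm)
  · rw [mem, mem]
    exact h.cover_right _

theorem shiftAct_mem_markerShift {Z D U V P : Set G} {s : G → Fin 2}
    (hs : s ∈ markerShift Z D U V P) (g : G) : shiftAct g s ∈ markerShift Z D U V P := by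
  obtain ⟨M, B, h, hsMB⟩ := hs
  refine ⟨g • M, g • B, h.translate g, fun x => ?_⟩
  rw [shiftAct, hsMB, smul_mul_assoc, smul_mul_assoc, Set.mem_smul_set_iff_inv_smul_mem,
    Set.mem_smul_set_iff_inv_smul_mem, smul_eq_mul]

theorem isClosed_markerShift {Z D U V P : Set G} (hZ : Z.Finite) (hD : D.Finite)
    (hU : U.Finite) (hV : V.Finite) (hP : P.Finite) : IsClosed (markerShift Z D U V P) := by
  have clopen_mem (f : ((G → Fin 2) × (G → Fin 2)) × (G → Fin 2) → G → Fin 2) (hf : Continuous f)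
      (g : G) :
      IsClopen {q | f q g = 1} :=
    (isClopen_discrete ({1} : Set (Fin 2))).preimage ((continuous_apply g).comp hf)
  have clopen_mul (f : ((G → Fin 2) × (G → Fin 2)) × (G → Fin 2) → G → Fin 2) (hf : Continuous f)
      {W : Set G} (hW : W.Finite) (g : G) :
      IsClopen {q | g ∈ {x | f q x = 1} * W} := by
    have : {q | g ∈ {x | f q x = 1} * W} = ⋃ w ∈ W, {q | f q (g * w⁻¹) = 1} := by
      ext q
      simp [Set.mem_mul_iff_exists_mul_inv_mem]
    rw [this]
    exact hW.isClopen_biUnion fun w _ => clopen_mem f hf _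
  have closed_sep (f : ((G → Fin 2) × (G → Fin 2)) × (G → Fin 2) → G → Fin 2) (hf : Continuous f)
      (W : Set G) :
      IsClosed {q | CrossSep W {x | f q x = 1} {x | f q x = 1}} := by
    simp only [CrossSep, Set.ofPred_forall, Set.mem_ofPred_eq]
    refine isClosed_iInter fun p => isClosed_imp (clopen_mem f hf p).isOpen ?_
    simp only [Set.ofPred_forall]
    refine isClosed_iInter fun q => isClosed_imp (clopen_mem f hf q).isOpen isClosed_const
  have hM : Continuous fun q : ((G → Fin 2) × (G → Fin 2)) × (G → Fin 2) => q.1.1 := by fun_prop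
  have hB : Continuous fun q : ((G → Fin 2) × (G → Fin 2)) × (G → Fin 2) => q.1.2 := by fun_prop
  have hs : Continuous fun q : ((G → Fin 2) × (G → Fin 2)) × (G → Fin 2) => q.2 := by fun_prop
  let K : Set (((G → Fin 2) × (G → Fin 2)) × (G → Fin 2)) := {q |
     IsMarkerPair Z D U {x | q.1.1 x = 1} {x | q.1.2 x = 1} ∧
    ∀ g, q.2 g = 1 ↔ g ∈ {x | q.1.1 x = 1} * V ∨ g ∈ {x | q.1.2 x = 1} * P}
  have hK : IsClosed K := by
    have hpair : IsClosed {q : ((G → Fin 2) × (G → Fin 2)) × (G → Fin 2) |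
        IsMarkerPair Z D U {x | q.1.1 x = 1} {x | q.1.2 x = 1}} := by
      simp only [isMarkerPair_iff, Set.ofPred_and, Set.ofPred_forall]
      refine (closed_sep _ hM Z).inter ((isClosed_iInter fun g =>
        (clopen_mul _ hM hZ g).isClosed).inter ((closed_sep _ hB U).inter
          ((isClosed_iInter fun b => isClosed_imp (clopen_mem _ hB b).isOpen
            (clopen_mul _ hM hD b).compl.isClosed).inter
              (isClosed_iInter fun g =>
                ((clopen_mul _ hB hU g).union (clopen_mul _ hM hD g)).isClosed))))
    have hconf : IsClosed {q : ((G → Fin 2) × (G → Fin 2)) × (G → Fin 2) |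
        ∀ g, q.2 g = 1 ↔ g ∈ {x | q.1.1 x = 1} * V ∨ g ∈ {x | q.1.2 x = 1} * P} := by
      simp only [iff_iff_implies_and_implies, Set.ofPred_forall, Set.ofPred_and]
      exact isClosed_iInter fun g =>
        (isClosed_imp (clopen_mem _ hs g).isOpen
          ((clopen_mul _ hM hV g).union (clopen_mul _ hB hP g)).isClosed).inter
        (isClosed_imp ((clopen_mul _ hM hV g).union (clopen_mul _ hB hP g)).isOpen
          (clopen_mem _ hs g).isClosed)
    exact hpair.inter hconf
  have himage : markerShift Z D U V P = Prod.snd '' K := by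
    classical
    ext s
    constructor
    · rintro ⟨M, B, h, hsMB⟩
      have e (M : Set G) : {x | (if x ∈ M then 1 else 0 : Fin 2) = 1} = M := by ext; simp
      refine ⟨((fun x => if x ∈ M then 1 else 0, fun x => if x ∈ B then 1 else 0), s), ⟨?_, ?_⟩,
        rfl⟩
      · simpa only [e] using h
      · simpa only [e] using hsMB
    · rintro ⟨q, hq, rfl⟩
      exact ⟨_, _, hq⟩
  rw [himage]
  exact isClosedMap_snd_of_compactSpace _ hK

end

/-- The points of `M` at `T`-distance at most `n` from `E`. -/
def nearPart {G : Type*} [Group G] (T : Set G) (n : ℕ) (E M : Set G) : Set G :=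
  {m | m ∈ M ∧ ∃ a ∈ E, a⁻¹ * m ∈ wordBall T n}

section

variable {G : Type*} [Group G]

theorem crossSep_nearPart_union {T Z E₁ E₂ M₁ M₂ : Set G} {n : ℕ} (hT : ∀ x ∈ T, x⁻¹ ∈ T)
    (hZT : Z ⊆ T) (hZ : ∀ z ∈ Z, z⁻¹ ∈ Z) (h₁ : CrossSep Z M₁ M₁) (h₂ : CrossSep Z M₂ M₂)
    (hfar : ∀ a ∈ E₁, ∀ b ∈ E₂, a⁻¹ * b ∉ wordBall T (n + 1 + n)) :
    CrossSep Z (nearPart T n E₁ M₁ ∪ nearPart T n E₂ M₂)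
      (nearPart T n E₁ M₁ ∪ nearPart T n E₂ M₂) := by
  have hcross : ∀ p ∈ nearPart T n E₁ M₁, ∀ q ∈ nearPart T n E₂ M₂, p⁻¹ * q ∉ Z := by
    rintro p ⟨-, a, ha, hap⟩ q ⟨-, b, hb, hbq⟩ h
    refine hfar a ha b hb ?_
    have := wordBall_mul (wordBall_mul hap (subset_wordBall T le_rfl (hZT h)))
      (wordBall_inv hT hbq)
    simpa [mul_assoc] using this
  rintro p (hp | hp) q (hq | hq) h
  · exact h₁ p hp.1 q hq.1 h
  · exact absurd h (hcross p hp q hq)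
  · exact absurd (by simpa using hZ _ h) (hcross q hq p hp)
  · exact h₂ p hp.1 q hq.1 h

variable {T Z D U M₁ B₁ M B E : Set G}

theorem IsMarkerPair.mem_left_of_near (hT : ∀ x ∈ T, x⁻¹ ∈ T) (hZT : Z ⊆ T)
    (h₁ : IsMarkerPair Z D U M₁ B₁) (hM : CrossSep Z M M) (hsub : nearPart T 4 E M₁ ⊆ M)
    {m a : G} (ha : a ∈ E) (hm : m ∈ M) (ham : a⁻¹ * m ∈ wordBall T 3) : m ∈ M₁ := by
  obtain ⟨m₁, hm₁, hz⟩ := Set.mem_mul_iff_exists_inv_mul_mem.1 (h₁.cover_left m)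
  have ham₁ : a⁻¹ * m₁ ∈ wordBall T 4 := by
    have := wordBall_mul ham (wordBall_inv hT (subset_wordBall T le_rfl (hZT hz)))
    simpa [mul_assoc] using this
  rwa [← hM m₁ (hsub ⟨hm₁, a, ha, ham₁⟩) m hm hz]

theorem IsMarkerPair.notMem_of_near (hT : ∀ x ∈ T, x⁻¹ ∈ T) (hZT : Z ⊆ T) (hDT : D ⊆ T)
    (h₁ : IsMarkerPair Z D U M₁ B₁) (hM : CrossSep Z M M) (hsub : nearPart T 4 E M₁ ⊆ M)
    {b : G} (hb : b ∈ nearPart T 2 E B₁) : b ∉ M * D := by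
  obtain ⟨hb, a, ha, hab⟩ := hb
  intro hbM
  obtain ⟨m, hm, hd⟩ := Set.mem_mul_iff_exists_inv_mul_mem.1 hbM
  have ham : a⁻¹ * m ∈ wordBall T 3 := by
    have := wordBall_mul hab (wordBall_inv hT (subset_wordBall T le_rfl (hDT hd)))
    simpa [mul_assoc] using this
  exact h₁.disjoint b hb
    (Set.mem_mul_iff_exists_inv_mul_mem.2 ⟨m, h₁.mem_left_of_near hT hZT hM hsub ha hm ham, hd⟩)

theorem IsMarkerPair.mem_right_of_near (hT : ∀ x ∈ T, x⁻¹ ∈ T) (hDT : D ⊆ T) (hUT : U ⊆ T)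
    (h₁ : IsMarkerPair Z D U M₁ B₁) (h : IsMarkerPair Z D U M B)
    (hsubM : nearPart T 4 E M₁ ⊆ M) (hsubB : nearPart T 2 E B₁ ⊆ B)
    {b a : G} (ha : a ∈ E) (hb : b ∈ B) (hab : a⁻¹ * b ∈ wordBall T 1) : b ∈ B₁ := by
  rcases h₁.cover_right b with hc | hc <;>
    obtain ⟨c, hc, hu⟩ := Set.mem_mul_iff_exists_inv_mul_mem.1 hc
  · have hac := wordBall_mul hab (wordBall_inv hT (subset_wordBall T le_rfl (hUT hu)))
    have hcB : c ∈ B := hsubB ⟨hc, a, ha, by simpa [mul_assoc] using hac⟩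
    rwa [← h.sep_right c hcB b hb hu]
  · have hac := wordBall_mul hab (wordBall_inv hT (subset_wordBall T le_rfl (hDT hu)))
    have hcM : c ∈ M :=
      hsubM ⟨hc, a, ha, wordBall_mono (m := 2) subset_rfl (by norm_num)
        (by simpa [mul_assoc] using hac)⟩
    exact absurd (Set.mem_mul_iff_exists_inv_mul_mem.2 ⟨c, hcM, hu⟩) (h.disjoint b hb)

theorem IsMarkerPair.mem_iff_of_near {V P : Set G} (hT : ∀ x ∈ T, x⁻¹ ∈ T) (hZT : Z ⊆ T)
    (hDT : D ⊆ T) (hUT : U ⊆ T) (hVT : V ⊆ T) (hPT : P ⊆ T)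
    (h₁ : IsMarkerPair Z D U M₁ B₁) (h : IsMarkerPair Z D U M B)
    (hsubM : nearPart T 4 E M₁ ⊆ M) (hsubB : nearPart T 2 E B₁ ⊆ B) {a : G} (ha : a ∈ E) :
    (a ∈ M * V ∨ a ∈ B * P) ↔ (a ∈ M₁ * V ∨ a ∈ B₁ * P) := by
  have near {m : G} {W : Set G} (hW : W ⊆ T) (hm : m⁻¹ * a ∈ W) : a⁻¹ * m ∈ wordBall T 1 := by
    simpa using wordBall_inv hT (subset_wordBall T le_rfl (hW hm))
  simp only [Set.mem_mul_iff_exists_inv_mul_mem]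
  refine or_congr (exists_congr fun m => and_congr_left fun hm => ⟨fun hmM => ?_, fun hmM => ?_⟩)
    (exists_congr fun m => and_congr_left fun hm => ⟨fun hmM => ?_, fun hmM => ?_⟩)
  · exact h₁.mem_left_of_near hT hZT h.sep_left hsubM ha hmM
      (wordBall_mono subset_rfl (by norm_num) (near hVT hm))
  · exact hsubM ⟨hmM, a, ha, wordBall_mono subset_rfl (by norm_num) (near hVT hm)⟩
  · exact h₁.mem_right_of_near hT hDT hUT h hsubM hsubB ha hmM (near hPT hm)
  · exact hsubB ⟨hmM, a, ha, wordBall_mono subset_rfl (by norm_num) (near hPT hm)⟩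

theorem stronglyIrreducible_markerShift {V P : Set G} (hZ1 : 1 ∈ Z) (hZ : ∀ z ∈ Z, z⁻¹ ∈ Z)
    (hU1 : 1 ∈ U) (hU : ∀ z ∈ U, z⁻¹ ∈ U) (hZf : Z.Finite) (hDf : D.Finite) (hUf : U.Finite)
    (hVf : V.Finite) (hPf : P.Finite) : StronglyIrreducible (markerShift Z D U V P) := by
  obtain ⟨T, hTf, hT, hZT, hDT, hUT, hVT, hPT⟩ : ∃ T : Set G, T.Finite ∧ (∀ x ∈ T, x⁻¹ ∈ T) ∧
      Z ⊆ T ∧ D ⊆ T ∧ U ⊆ T ∧ V ⊆ T ∧ P ⊆ T := by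
    have hf := (((hZf.union hDf).union hUf).union hVf).union hPf
    refine ⟨_, hf.union hf.inv, fun x hx => ?_, ?_, ?_, ?_, ?_, ?_⟩
    · rcases hx with hx | hx
      exacts [Or.inr (by simpa only [Set.mem_inv, inv_inv] using hx), Or.inl hx]
    all_goals intro x hx; simp [hx]
  refine ⟨(wordBall_finite hTf 5).toFinset, by simpa using one_mem_wordBall T 5, ?_⟩
  rintro E₁ E₂ hE s₁ ⟨M₁, B₁, h₁, hs₁⟩ s₂ ⟨M₂, B₂, h₂, hs₂⟩
  have hfar : ∀ a ∈ E₁, ∀ b ∈ E₂, a⁻¹ * b ∉ wordBall T 10 := by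
    intro a ha b hb hab
    obtain ⟨u, hu, v, hv, huv⟩ := exists_mul_of_mem_wordBall (m := 5) (n := 5) hab
    refine Set.eq_empty_iff_forall_notMem.1 hE (a * u)
      ⟨Set.mul_mem_mul ha (by simpa using hu), b, hb, v⁻¹, by simpa using wordBall_inv hT hv, ?_⟩
    rw [← mul_inv_eq_iff_eq_mul.2 huv.symm]
    group
  obtain ⟨M, B, hM, hB, h⟩ := IsMarkerPair.exists_extension (D := D) hZ1 hZ hU1 hU
    (crossSep_nearPart_union (n := 4) hT hZT hZ h₁.sep_left h₂.sep_left fun a ha b hb hab =>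
      hfar a ha b hb (wordBall_mono subset_rfl (by norm_num) hab))
    (crossSep_nearPart_union (n := 2) hT hUT hU h₁.sep_right h₂.sep_right fun a ha b hb hab =>
      hfar a ha b hb (wordBall_mono subset_rfl (by norm_num) hab)) (by
    rintro M hM hMs c (hc | hc)
    · exact h₁.notMem_of_near hT hZT hDT hMs (Set.subset_union_left.trans hM) hc
    · exact h₂.notMem_of_near hT hZT hDT hMs (Set.subset_union_right.trans hM) hc)
  classical
  have hs (g : G) : (if g ∈ M * V ∨ g ∈ B * P then 1 else 0 : Fin 2) = 1 ↔
      g ∈ M * V ∨ g ∈ B * P := by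
    split_ifs with hg <;> simp [hg]
  have fin_two_eq : ∀ {x y : Fin 2}, (x = 1 ↔ y = 1) → x = y := by decide
  refine ⟨_, ⟨M, B, h, hs⟩, fun a ha => fin_two_eq ?_, fun a ha => fin_two_eq ?_⟩
  · rw [hs, hs₁]
    exact h₁.mem_iff_of_near hT hZT hDT hUT hVT hPT h (Set.subset_union_left.trans hM)
      (Set.subset_union_left.trans hB) ha
  · rw [hs, hs₂]
    exact h₂.mem_iff_of_near hT hZT hDT hUT hVT hPT h (Set.subset_union_right.trans hM)
      (Set.subset_union_right.trans hB) ha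

theorem markerShift_nonempty {V P : Set G} (hZ1 : 1 ∈ Z) (hZ : ∀ z ∈ Z, z⁻¹ ∈ Z)
    (hU1 : 1 ∈ U) (hU : ∀ z ∈ U, z⁻¹ ∈ U) : (markerShift Z D U V P).Nonempty := by
  classical
  obtain ⟨M, B, -, -, h⟩ := IsMarkerPair.exists_extension (D := D) (A := ∅) (C := ∅)
    hZ1 hZ hU1 hU (by simp [CrossSep]) (by simp [CrossSep]) (by simp)
  exact ⟨fun g => if g ∈ M * V ∨ g ∈ B * P then 1 else 0, M, B, h, fun g => by
    beta_reduce
    split_ifs with hg <;> simp [hg]⟩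

theorem isWitnessShift_markerShift {X : Finset G} {P W V : Set G} (hXi : ∀ x ∈ X, x⁻¹ ∈ X)
    (hWV : W ⊆ V) (hP : CrossSep X P P) (hV : CrossSep X V V)
    (hPV : ∀ k ∈ P * X * P⁻¹, ∃ w ∈ W, k * w ∈ P)
    (hVV : ∀ k ∈ V * X * P⁻¹, ∃ w ∈ W, k * w ∈ V) :
    IsWitnessShift X (markerShift (V * X * V⁻¹) (V * X * P⁻¹) (P * X * P⁻¹) V P) := by
  have key {A C : Set G} {m n v w : G} (hv : v ∈ A) (hw : w ∈ C)
      (hx : (m * v)⁻¹ * (n * w) ∈ X) : m⁻¹ * n ∈ A * X * C⁻¹ :=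
    mem_mul_mul_inv.2 ⟨v, hv, _, hx, w, hw, by group⟩
  refine ⟨?_, ?_⟩
  · rintro s ⟨M, B, h, hs⟩ a b ha hb hab hX
    refine hab ?_
    rcases (hs a).1 ha with ⟨m, hm, v, hv, rfl⟩ | ⟨m, hm, v, hv, rfl⟩ <;>
      rcases (hs b).1 hb with ⟨n, hn, w, hw, rfl⟩ | ⟨n, hn, w, hw, rfl⟩
    · obtain rfl := h.sep_left m hm n hn (key hv hw hX)
      simp only [mul_right_inj]
      exact hV v hv w hw (by simpa [mul_assoc] using hX)
    · exact absurd (Set.mem_mul_iff_exists_inv_mul_mem.2 ⟨m, hm, key hv hw hX⟩) (h.disjoint n hn)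
    · have hX' := hXi _ hX
      rw [mul_inv_rev, inv_inv] at hX'
      exact absurd (Set.mem_mul_iff_exists_inv_mul_mem.2 ⟨n, hn, key hw hv hX'⟩)
        (h.disjoint m hm)
    · obtain rfl := h.sep_right m hm n hn (key hv hw hX)
      simp only [mul_right_inj]
      exact hP v hv w hw (by simpa [mul_assoc] using hX)
  · rintro s ⟨M, B, h, hs⟩ t ⟨M', B', h', ht⟩
    obtain ⟨m, hm, -⟩ := h'.cover_left 1
    suffices ∃ w ∈ W, s (m * w) = 1 by
      obtain ⟨w, hw, hsw⟩ := this
      exact ⟨m * w, hsw, (ht _).2 (Or.inl (Set.mul_mem_mul hm (hWV hw)))⟩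
    rcases h.cover_right m with hb | hb <;>
      obtain ⟨b, hb, hk⟩ := Set.mem_mul_iff_exists_inv_mul_mem.1 hb
    · obtain ⟨w, hw, hkw⟩ := hPV _ hk
      exact ⟨w, hw, (hs _).2 (Or.inr (Set.mem_mul_iff_exists_inv_mul_mem.2
        ⟨b, hb, by rwa [← mul_assoc]⟩))⟩
    · obtain ⟨w, hw, hkw⟩ := hVV _ hk
      exact ⟨w, hw, (hs _).2 (Or.inl (Set.mem_mul_iff_exists_inv_mul_mem.2
        ⟨b, hb, by rwa [← mul_assoc]⟩))⟩

theorem one_mem_mul_mul_inv {A X : Set G} (hA : A.Nonempty) (hX : 1 ∈ X) : 1 ∈ A * X * A⁻¹ := by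
  obtain ⟨a, ha⟩ := hA
  exact mem_mul_mul_inv.2 ⟨a, ha, 1, hX, a, ha, by group⟩

theorem inv_mem_mul_mul_inv {A X : Set G} (hX : ∀ x ∈ X, x⁻¹ ∈ X) :
    ∀ g ∈ A * X * A⁻¹, g⁻¹ ∈ A * X * A⁻¹ := by
  intro g hg
  obtain ⟨a, ha, x, hx, c, hc, rfl⟩ := mem_mul_mul_inv.1 hg
  exact mem_mul_mul_inv.2 ⟨c, hc, x⁻¹, hX x hx, a, ha, by group⟩

end

/-- Let `G` be a countable ICC group.  Then for every finite symmetric `X ⊆ G` containing the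
identity with `|X| ≥ 2` there is a strongly irreducible `X`-witness shift `S ⊆ 2^G`. -/
theorem icc_exists_stronglyIrreducible_witness_shift
    (G : Type) [Group G] [Countable G] [DecidableEq G] (hICC : IsICC G)
    (X : Finset G) (hXsym : ∀ x ∈ X, x⁻¹ ∈ X) (hXone : (1 : G) ∈ X)
    (hXcard : 2 ≤ X.card) :
    ∃ S : Set (G → Fin 2), IsShift S ∧ StronglyIrreducible S ∧ IsWitnessShift X S := by
  obtain ⟨P, W, V, hPf, hVf, hP1, hW, hWV, hP, hV, hPV, hVV⟩ := exists_patterns hICC X hXone hXsym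
  have hXf := X.finite_toSet
  have hZ1 : 1 ∈ V * (X : Set G) * V⁻¹ := one_mem_mul_mul_inv (hW.mono hWV) hXone
  have hZ : ∀ z ∈ V * (X : Set G) * V⁻¹, z⁻¹ ∈ V * (X : Set G) * V⁻¹ := inv_mem_mul_mul_inv hXsym
  have hU1 : 1 ∈ P * (X : Set G) * P⁻¹ := one_mem_mul_mul_inv ⟨1, hP1⟩ hXone
  have hU : ∀ z ∈ P * (X : Set G) * P⁻¹, z⁻¹ ∈ P * (X : Set G) * P⁻¹ := inv_mem_mul_mul_inv hXsym
  have hZf := (hVf.mul hXf).mul hVf.inv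
  have hDf := (hVf.mul hXf).mul hPf.inv
  have hUf := (hPf.mul hXf).mul hPf.inv
  exact ⟨markerShift (V * X * V⁻¹) (V * X * P⁻¹) (P * X * P⁻¹) V P,
    ⟨markerShift_nonempty hZ1 hZ hU1 hU, isClosed_markerShift hZf hDf hUf hVf hPf,
      fun s hs g => shiftAct_mem_markerShift hs g⟩,
    stronglyIrreducible_markerShift hZ1 hZ hU1 hU hZf hDf hUf hVf hPf,
    isWitnessShift_markerShift hXsym hWV hP hV hPV hVV⟩
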